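/- Let R be a commutative ring, A a strongly commutative DG R-algebra, n a positive integer, and B = A[X_1,…,X_n] a polynomial extension of A by variables X_1,…,X_n of positive degrees. If N is a bounded below semifree DG B-module with Ext^i_B(N,N) = 0 for all i > 0, then N is naively liftable to A; moreover, N is a direct summand of a DG B-module that is liftable to A. -/

import Mathlib

/-!
Common framework: strongly commutative non-negatively graded DG algebras over a
commutative ring `R`, right DG modules, semifree DG modules, Ext via the Hom complex,
homotopies, enveloping DG algebras, diagonal ideals, DG (quasi-)smoothness,
polynomial and free (divided power) extensions, and naive lifting.
-/

noncomputable section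

/-- The Koszul sign `(-1)^i` for an integer `i`. -/
def ksign (i : ℤ) : ℤ := (((-1 : ℤˣ) ^ i : ℤˣ) : ℤ)

/-- A strongly commutative, non-negatively graded differential graded algebra over a
commutative ring `R`: a graded `R`-algebra `A = ⊕_{n ≥ 0} A_n` with
`a * b = (-1)^{|a||b|} b * a`, `a^2 = 0` for `|a|` odd, and an `R`-linear degree `-1`
differential `d` with `d ∘ d = 0` satisfying the Leibniz rule. -/
structure DGAlgebra (R : Type) [CommRing R] where
  carrier : Type
  [ring : Ring carrier]
  [alg : Algebra R carrier]
  grading : ℤ → Submodule R carrier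
  indep : ∀ i : ℤ, Disjoint (grading i) (⨆ j ≠ i, grading j)
  spanning : (⨆ i, grading i) = ⊤
  nonneg : ∀ i : ℤ, i < 0 → grading i = ⊥
  one_mem : (1 : carrier) ∈ grading 0
  mul_mem : ∀ {i j : ℤ} {a b : carrier}, a ∈ grading i → b ∈ grading j →
    a * b ∈ grading (i + j)
  gcomm : ∀ {i j : ℤ} (a b : carrier), a ∈ grading i → b ∈ grading j →
    a * b = ksign (i * j) • (b * a)
  odd_sq : ∀ {i : ℤ} (a : carrier), Odd i → a ∈ grading i → a * a = 0
  d : carrier → carrier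
  d_add : ∀ a b, d (a + b) = d a + d b
  d_rsmul : ∀ (r : R) a, d (r • a) = r • d a
  d_mem : ∀ {i : ℤ} {a : carrier}, a ∈ grading i → d a ∈ grading (i - 1)
  d_sq : ∀ a, d (d a) = 0
  leibniz : ∀ {i : ℤ} (a b : carrier), a ∈ grading i →
    d (a * b) = d a * b + ksign i • (a * d b)

attribute [instance] DGAlgebra.ring DGAlgebra.alg

variable {R : Type} [CommRing R]

/-- A right DG module over a DG `R`-algebra `A`. -/
structure DGModule (R : Type) [CommRing R] (A : DGAlgebra R) where
  carrier : Type
  [acg : AddCommGroup carrier]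
  [modR : Module R carrier]
  grading : ℤ → Submodule R carrier
  indep : ∀ i : ℤ, Disjoint (grading i) (⨆ j ≠ i, grading j)
  spanning : (⨆ i, grading i) = ⊤
  smul : carrier → A.carrier → carrier
  smul_add : ∀ (m : carrier) (a b : A.carrier), smul m (a + b) = smul m a + smul m b
  add_smul : ∀ (m n : carrier) (a : A.carrier), smul (m + n) a = smul m a + smul n a
  smul_rsmul : ∀ (r : R) (m : carrier) (a : A.carrier), smul m (r • a) = r • smul m a
  rsmul_smul : ∀ (r : R) (m : carrier) (a : A.carrier), smul (r • m) a = r • smul m a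
  smul_one : ∀ m : carrier, smul m 1 = m
  smul_mul : ∀ (m : carrier) (a b : A.carrier), smul (smul m a) b = smul m (a * b)
  smul_mem : ∀ {i j : ℤ} {m : carrier} {a : A.carrier},
    m ∈ grading i → a ∈ A.grading j → smul m a ∈ grading (i + j)
  d : carrier → carrier
  d_add : ∀ x y, d (x + y) = d x + d y
  d_rsmul : ∀ (r : R) x, d (r • x) = r • d x
  d_mem : ∀ {i : ℤ} {m : carrier}, m ∈ grading i → d m ∈ grading (i - 1)
  d_sq : ∀ m, d (d m) = 0
  leibniz : ∀ {i : ℤ} (m : carrier) (a : A.carrier), m ∈ grading i →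
    d (smul m a) = smul (d m) a + ksign i • smul m (A.d a)

attribute [instance] DGModule.acg DGModule.modR

/-- A graded `A`-linear map of degree `k` between DG `A`-modules (not necessarily
compatible with the differentials). -/
structure GradedHom {A : DGAlgebra R} (M N : DGModule R A) (k : ℤ) where
  toFun : M.carrier → N.carrier
  map_add : ∀ x y, toFun (x + y) = toFun x + toFun y
  map_rsmul : ∀ (r : R) x, toFun (r • x) = r • toFun x
  map_smul : ∀ (x : M.carrier) (a : A.carrier), toFun (M.smul x a) = N.smul (toFun x) a
  map_mem : ∀ {i : ℤ} {x : M.carrier}, x ∈ M.grading i → toFun x ∈ N.grading (i + k)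

/-- A homomorphism of DG `A`-modules: a degree `0` graded `A`-linear chain map. -/
structure DGHom {A : DGAlgebra R} (M N : DGModule R A) where
  toFun : M.carrier → N.carrier
  map_add : ∀ x y, toFun (x + y) = toFun x + toFun y
  map_rsmul : ∀ (r : R) x, toFun (r • x) = r • toFun x
  map_smul : ∀ (x : M.carrier) (a : A.carrier), toFun (M.smul x a) = N.smul (toFun x) a
  map_mem : ∀ {i : ℤ} {x : M.carrier}, x ∈ M.grading i → toFun x ∈ N.grading i
  comm_d : ∀ x, toFun (M.d x) = N.d (toFun x)

/-- A degree `-k` element `f` of the Hom complex `Hom_A(N, M)` is a cocycle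
(representing a class in `Ext^k_A(N,M) = H_{-k}(Hom_A(N,M))`). -/
def IsExtCocycle {A : DGAlgebra R} {N M : DGModule R A} (k : ℤ)
    (f : GradedHom N M (-k)) : Prop :=
  ∀ x, M.d (f.toFun x) = ksign k • f.toFun (N.d x)

/-- A degree `-k` cocycle of the Hom complex is a coboundary. -/
def IsExtCoboundary {A : DGAlgebra R} {N M : DGModule R A} (k : ℤ)
    (f : GradedHom N M (-k)) : Prop :=
  ∃ h : GradedHom N M (-k + 1), ∀ x,
    f.toFun x = M.d (h.toFun x) + ksign k • h.toFun (N.d x)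

/-- `Ext^k_A(N, M) = H_{-k}(Hom_A(N, M)) = 0`. -/
def ExtVanish {A : DGAlgebra R} (k : ℤ) (N M : DGModule R A) : Prop :=
  ∀ f : GradedHom N M (-k), IsExtCocycle k f → IsExtCoboundary k f

/-- A DG module homomorphism `j : M' → M` induces an isomorphism
`Ext^k_A(N, M') ≅ Ext^k_A(N, M)`; stated at the level of cocycles and coboundaries
of the Hom complexes (injectivity and surjectivity of the induced map on `H_{-k}`). -/
def InducesExtIso {A : DGAlgebra R} (k : ℤ) (N : DGModule R A) {M' M : DGModule R A}
    (j : DGHom M' M) : Prop :=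
  (∀ f : GradedHom N M' (-k), IsExtCocycle k f →
    (∃ h : GradedHom N M (-k + 1), ∀ x,
      j.toFun (f.toFun x) = M.d (h.toFun x) + ksign k • h.toFun (N.d x)) →
    IsExtCoboundary k f) ∧
  (∀ g : GradedHom N M (-k), IsExtCocycle k g →
    ∃ f : GradedHom N M' (-k), IsExtCocycle k f ∧
      ∃ h : GradedHom N M (-k + 1), ∀ x,
        j.toFun (f.toFun x) - g.toFun x = M.d (h.toFun x) + ksign k • h.toFun (N.d x))

/-- Two maps of DG `A`-modules are homotopic: `f - g = ∂ ∘ h + h ∘ ∂` for a graded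
`A`-linear map `h` of degree `1`. -/
def DGHomotopic {A : DGAlgebra R} {M N : DGModule R A}
    (f g : M.carrier → N.carrier) : Prop :=
  ∃ h : GradedHom M N 1, ∀ x, f x - g x = N.d (h.toFun x) + h.toFun (M.d x)

/-- A DG module homomorphism `j : M' → M` induces a bijection
`Hom_{K(A)}(N, M') ≅ Hom_{K(A)}(N, M)` on homotopy classes of DG homomorphisms. -/
def InducesHtpyBij {A : DGAlgebra R} (N : DGModule R A) {M' M : DGModule R A}
    (j : DGHom M' M) : Prop :=
  (∀ f g : DGHom N M',
    DGHomotopic (fun x => j.toFun (f.toFun x)) (fun x => j.toFun (g.toFun x)) →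
    DGHomotopic f.toFun g.toFun) ∧
  (∀ g : DGHom N M, ∃ f : DGHom N M',
    DGHomotopic (fun x => j.toFun (f.toFun x)) g.toFun)

/-- A semifree basis of a DG `A`-module `N` on a family `e : κ → N`: a well-ordering
of `κ`, degrees making each `e k` homogeneous, such that `e` is a basis of the
underlying graded `A`-module and `∂(e k) ∈ Σ_{j < k} (e j)·A`. -/
structure SemifreeBasisOn {A : DGAlgebra R} (N : DGModule R A) {κ : Type}
    (e : κ → N.carrier) where
  lt : κ → κ → Prop
  wf : WellFounded lt
  trans : ∀ a b c, lt a b → lt b c → lt a c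
  trichotomous : ∀ a b, lt a b ∨ a = b ∨ lt b a
  deg : κ → ℤ
  homog : ∀ k, e k ∈ N.grading (deg k)
  basis : Function.Bijective
    (fun c : κ →₀ A.carrier => c.sum fun k a => N.smul (e k) a)
  d_lower : ∀ k, ∃ c : κ →₀ A.carrier, (∀ j ∈ c.support, lt j k) ∧
    N.d (e k) = c.sum fun j a => N.smul (e j) a

/-- A DG `A`-module is semifree if it admits a semifree basis. -/
def IsSemifree {A : DGAlgebra R} (N : DGModule R A) : Prop :=
  ∃ (κ : Type) (e : κ → N.carrier), Nonempty (SemifreeBasisOn N e)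

/-- A DG `A`-module has a finite semifree basis. -/
def HasFiniteSemifreeBasis {A : DGAlgebra R} (N : DGModule R A) : Prop :=
  ∃ (κ : Type) (e : κ → N.carrier), Finite κ ∧ Nonempty (SemifreeBasisOn N e)

/-- A DG module is bounded below: `N_i = 0` for `i ≪ 0`. -/
def BoundedBelow {A : DGAlgebra R} (N : DGModule R A) : Prop :=
  ∃ n₀ : ℤ, ∀ i : ℤ, i < n₀ → N.grading i = ⊥

/-- A homomorphism of DG `R`-algebras. -/
structure DGAlgHom (A B : DGAlgebra R) where
  toFun : A.carrier → B.carrier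
  map_one : toFun 1 = 1
  map_mul : ∀ x y, toFun (x * y) = toFun x * toFun y
  map_add : ∀ x y, toFun (x + y) = toFun x + toFun y
  map_rsmul : ∀ (r : R) x, toFun (r • x) = r • toFun x
  map_mem : ∀ {i : ℤ} {x : A.carrier}, x ∈ A.grading i → toFun x ∈ B.grading i
  comm_d : ∀ x, toFun (A.d x) = B.d (toFun x)

/-- A DG `A`-module homomorphism from a DG `A`-module `M` to (the restriction of
scalars along `φ : A → B` of) a DG `B`-module `W`. -/
structure ResHom {A B : DGAlgebra R} (φ : DGAlgHom A B) (M : DGModule R A)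
    (W : DGModule R B) where
  toFun : M.carrier → W.carrier
  map_add : ∀ x y, toFun (x + y) = toFun x + toFun y
  map_rsmul : ∀ (r : R) x, toFun (r • x) = r • toFun x
  map_mem : ∀ {i : ℤ} {x : M.carrier}, x ∈ M.grading i → toFun x ∈ W.grading i
  map_smul : ∀ (x : M.carrier) (a : A.carrier),
    toFun (M.smul x a) = W.smul (toFun x) (φ.toFun a)
  comm_d : ∀ x, toFun (M.d x) = W.d (toFun x)

/-- `T` is (up to isomorphism) the base change `M ⊗_A B` of the DG `A`-module `M`
along `φ : A → B`: universal property of the unit map `M → T`, `m ↦ m ⊗ 1`. -/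
structure DGBaseChange {A B : DGAlgebra R} (φ : DGAlgHom A B) (M : DGModule R A)
    (T : DGModule R B) where
  unit : ResHom φ M T
  univ : ∀ (W : DGModule R B) (f : ResHom φ M W),
    ∃ g : DGHom T W, (∀ x, g.toFun (unit.toFun x) = f.toFun x) ∧
      ∀ g' : DGHom T W, (∀ x, g'.toFun (unit.toFun x) = f.toFun x) →
        ∀ t, g'.toFun t = g.toFun t

/-- A DG `B`-module `W` is liftable to `A` along `φ : A → B` if `W ≅ M ⊗_A B`
for some DG `A`-module `M`. -/
def LiftableTo {A B : DGAlgebra R} (φ : DGAlgHom A B) (W : DGModule R B) : Prop :=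
  ∃ M : DGModule R A, Nonempty (DGBaseChange φ M W)

/-- An `A`-linear (via `φ : A → B`) chain map between the restrictions of two
DG `B`-modules. -/
structure ResHomB {A B : DGAlgebra R} (φ : DGAlgHom A B) (N W : DGModule R B) where
  toFun : N.carrier → W.carrier
  map_add : ∀ x y, toFun (x + y) = toFun x + toFun y
  map_rsmul : ∀ (r : R) x, toFun (r • x) = r • toFun x
  map_mem : ∀ {i : ℤ} {x : N.carrier}, x ∈ N.grading i → toFun x ∈ W.grading i
  map_smul : ∀ (x : N.carrier) (a : A.carrier),
    toFun (N.smul x (φ.toFun a)) = W.smul (toFun x) (φ.toFun a)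
  comm_d : ∀ x, toFun (N.d x) = W.d (toFun x)

/-- `T` is (up to isomorphism) the induced DG `B`-module `N|_A ⊗_A B` of a
DG `B`-module `N` along `φ : A → B`, with unit map `n ↦ n ⊗ 1`. -/
structure InducedModuleSpec {A B : DGAlgebra R} (φ : DGAlgHom A B)
    (N T : DGModule R B) where
  unit : ResHomB φ N T
  univ : ∀ (W : DGModule R B) (f : ResHomB φ N W),
    ∃ g : DGHom T W, (∀ x, g.toFun (unit.toFun x) = f.toFun x) ∧
      ∀ g' : DGHom T W, (∀ x, g'.toFun (unit.toFun x) = f.toFun x) →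
        ∀ t, g'.toFun t = g.toFun t

/-- `N` is naively liftable to `A` along `φ : A → B`: the canonical DG `B`-module
epimorphism `π_N : N|_A ⊗_A B → N`, `n ⊗ b ↦ nb` (characterized as the unique
DG `B`-map splitting the unit) admits a right inverse DG `B`-module homomorphism. -/
def NaivelyLiftable {A B : DGAlgebra R} (φ : DGAlgHom A B) (N : DGModule R B) : Prop :=
  ∀ (T : DGModule R B) (h : InducedModuleSpec φ N T) (πN : DGHom T N),
    (∀ x, πN.toFun (h.unit.toFun x) = x) →
    ∃ ρ : DGHom N T, ∀ y, πN.toFun (ρ.toFun y) = y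

/-- `N` is a direct summand of `W` as DG modules. -/
def IsDGDirectSummandOf {A : DGAlgebra R} (N W : DGModule R A) : Prop :=
  ∃ (ρ : DGHom N W) (p : DGHom W N), ∀ x, p.toFun (ρ.toFun x) = x

/-- `N` is a direct summand of some DG `B`-module which is liftable to `A`. -/
def DirectSummandOfLiftable {A B : DGAlgebra R} (φ : DGAlgHom A B)
    (N : DGModule R B) : Prop :=
  ∃ W : DGModule R B, LiftableTo φ W ∧ IsDGDirectSummandOf N W

/-- `B` is free as an underlying graded `A`-module (via `φ : A → B`), with a basis
of homogeneous elements. -/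
def FreeOverBase {A B : DGAlgebra R} (φ : DGAlgHom A B) : Prop :=
  ∃ (κ : Type) (e : κ → B.carrier) (dg : κ → ℤ),
    (∀ k, e k ∈ B.grading (dg k)) ∧
    Function.Bijective (fun c : κ →₀ A.carrier => c.sum fun k a => e k * φ.toFun a)

/-- `E` is (up to isomorphism) the enveloping DG algebra `B^e = B^o ⊗_A B` of
`φ : A → B`: it receives the two canonical maps `l : B° → E`, `b ↦ b^o ⊗ 1` and
`r : B → E`, `b ↦ 1^o ⊗ b` agreeing on `A`, and is universal (as a pushout of
strongly commutative DG algebras) with this property. -/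
structure EnvelopingAlg {A B : DGAlgebra R} (φ : DGAlgHom A B) (E : DGAlgebra R) where
  l : DGAlgHom B E
  r : DGAlgHom B E
  compat : ∀ a, l.toFun (φ.toFun a) = r.toFun (φ.toFun a)
  univ : ∀ (C : DGAlgebra R) (f g : DGAlgHom B C),
    (∀ a, f.toFun (φ.toFun a) = g.toFun (φ.toFun a)) →
    ∃ h : DGAlgHom E C, (∀ b, h.toFun (l.toFun b) = f.toFun b) ∧
      (∀ b, h.toFun (r.toFun b) = g.toFun b) ∧
      ∀ h' : DGAlgHom E C,
        ((∀ b, h'.toFun (l.toFun b) = f.toFun b) ∧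
          (∀ b, h'.toFun (r.toFun b) = g.toFun b)) → ∀ x, h'.toFun x = h.toFun x

/-- The diagonal ideal `J = ker(π_B : B^e → B)`. -/
def diagIdeal {A B E : DGAlgebra R} {φ : DGAlgHom A B} (_ : EnvelopingAlg φ E)
    (πB : DGAlgHom E B) : Set E.carrier :=
  {x | πB.toFun x = 0}

/-- A balanced pairing `N × S → W` realizing (maps out of) `N ⊗_B (S/Z)`, where
`S ⊆ B^e` is a DG `(B,B)`-sub-bimodule of `B^e` (left `B`-action via `l`, right
`B`-action via `r`) and `Z ⊆ S` is killed. -/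
structure TensorPairing {A B E : DGAlgebra R} (φ : DGAlgHom A B)
    (he : EnvelopingAlg φ E) (S Z : Set E.carrier) (N W : DGModule R B) where
  pair : N.carrier → E.carrier → W.carrier
  add_left : ∀ n n' x, x ∈ S → pair (n + n') x = pair n x + pair n' x
  add_right : ∀ n x y, x ∈ S → y ∈ S → pair n (x + y) = pair n x + pair n y
  rsmul_left : ∀ (r : R) n x, x ∈ S → pair (r • n) x = r • pair n x
  rsmul_right : ∀ (r : R) n x, x ∈ S → pair n (r • x) = r • pair n x
  balanced : ∀ (n : N.carrier) (b : B.carrier) (x : E.carrier), x ∈ S →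
    pair (N.smul n b) x = pair n (he.l.toFun b * x)
  act_right : ∀ (n : N.carrier) (b : B.carrier) (x : E.carrier), x ∈ S →
    pair n (x * he.r.toFun b) = W.smul (pair n x) b
  grade : ∀ {i j : ℤ} (n : N.carrier) (x : E.carrier),
    n ∈ N.grading i → x ∈ S → x ∈ E.grading j → pair n x ∈ W.grading (i + j)
  chain : ∀ {i : ℤ} (n : N.carrier) (x : E.carrier), n ∈ N.grading i → x ∈ S →
    W.d (pair n x) = pair (N.d n) x + ksign i • pair n (E.d x)
  kill : ∀ n x, x ∈ Z → pair n x = 0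

/-- `P` is (up to isomorphism) the right DG `B`-module `N ⊗_B (S/Z)`:
universal property among balanced pairings. -/
structure IsTensorSubquot {A B E : DGAlgebra R} (φ : DGAlgHom A B)
    (he : EnvelopingAlg φ E) (S Z : Set E.carrier) (N P : DGModule R B) where
  pairing : TensorPairing φ he S Z N P
  univ : ∀ (W : DGModule R B) (γ : TensorPairing φ he S Z N W),
    ∃ g : DGHom P W, (∀ n x, x ∈ S → g.toFun (pairing.pair n x) = γ.pair n x) ∧
      ∀ g' : DGHom P W, (∀ n x, x ∈ S → g'.toFun (pairing.pair n x) = γ.pair n x) →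
        ∀ p, g'.toFun p = g.toFun p

/-- `Q` is (up to isomorphism) the quotient `S/Z` of DG `B^e`-submodules
`Z ⊆ S ⊆ B^e`, regarded as a right DG `B`-module via `r : B → B^e`. -/
structure SubquotModSpec {A B E : DGAlgebra R} {φ : DGAlgHom A B}
    (he : EnvelopingAlg φ E) (S Z : Set E.carrier) (Q : DGModule R B) where
  q : E.carrier → Q.carrier
  q_add : ∀ x y, x ∈ S → y ∈ S → q (x + y) = q x + q y
  q_rsmul : ∀ (r : R) x, x ∈ S → q (r • x) = r • q x
  q_mem : ∀ {i : ℤ} (x : E.carrier), x ∈ S → x ∈ E.grading i → q x ∈ Q.grading i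
  q_d : ∀ x, x ∈ S → q (E.d x) = Q.d (q x)
  q_act : ∀ (x : E.carrier) (b : B.carrier), x ∈ S →
    q (x * he.r.toFun b) = Q.smul (q x) b
  q_surj : ∀ y, ∃ x ∈ S, q x = y
  q_ker : ∀ x, x ∈ S → (q x = 0 ↔ x ∈ Z)

/-- The data exhibiting `φ : A → B` as DG quasi-smooth, relative to a realization
`E` of the enveloping DG algebra `B^e` and the multiplication map `π_B : B^e → B`:
`B` is graded-free over `A` and the diagonal ideal `J = ker π_B` carries a filtration
`J = J^[1] ⊇ J^[2] ⊇ ⋯` of DG `B^e`-submodules with `J·J^[ℓ] + J^[ℓ]·J ⊆ J^[ℓ+1]`,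
`inf J^[ℓ] ≥ ℓ`, and all subquotients `J^[ℓ]/J^[ℓ+1]` semifree over `B`. -/
structure QuasiSmoothData {A B : DGAlgebra R} (φ : DGAlgHom A B) (E : DGAlgebra R)
    (he : EnvelopingAlg φ E) (πB : DGAlgHom E B) where
  pil : ∀ b, πB.toFun (he.l.toFun b) = b
  pir : ∀ b, πB.toFun (he.r.toFun b) = b
  free : FreeOverBase φ
  filt : ℕ → Set E.carrier
  filt_one : filt 1 = {x | πB.toFun x = 0}
  filt_desc : ∀ ℓ, 1 ≤ ℓ → filt (ℓ + 1) ⊆ filt ℓ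
  filt_zero : ∀ ℓ, (0 : E.carrier) ∈ filt ℓ
  filt_add : ∀ ℓ x y, x ∈ filt ℓ → y ∈ filt ℓ → x + y ∈ filt ℓ
  filt_neg : ∀ ℓ x, x ∈ filt ℓ → -x ∈ filt ℓ
  filt_rsmul : ∀ ℓ (r : R) x, x ∈ filt ℓ → r • x ∈ filt ℓ
  filt_act : ∀ ℓ (e : E.carrier) x, x ∈ filt ℓ → x * e ∈ filt ℓ
  filt_d : ∀ ℓ x, x ∈ filt ℓ → E.d x ∈ filt ℓ
  filt_graded : ∀ ℓ x, x ∈ filt ℓ →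
    x ∈ Submodule.span R (filt ℓ ∩ ⋃ i : ℤ, (E.grading i : Set E.carrier))
  filt_mul : ∀ ℓ, 1 ≤ ℓ → ∀ a x, πB.toFun a = 0 → x ∈ filt ℓ →
    a * x ∈ filt (ℓ + 1) ∧ x * a ∈ filt (ℓ + 1)
  filt_inf : ∀ ℓ : ℕ, 1 ≤ ℓ → ∀ i : ℤ, i < (ℓ : ℤ) →
    ∀ x ∈ filt ℓ, x ∈ E.grading i → x = 0
  quot_semifree : ∀ ℓ, 1 ≤ ℓ → ∃ Q : DGModule R B,
    Nonempty (SubquotModSpec he (filt ℓ) (filt (ℓ + 1)) Q) ∧ IsSemifree Q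

/-- The data exhibiting `φ : A → B` as DG smooth: quasi-smooth, and all
subquotients `J^[ℓ]/J^[ℓ+1]` have finite semifree bases. -/
structure SmoothData {A B : DGAlgebra R} (φ : DGAlgHom A B) (E : DGAlgebra R)
    (he : EnvelopingAlg φ E) (πB : DGAlgHom E B)
    extends QuasiSmoothData φ E he πB where
  quot_finite : ∀ ℓ, 1 ≤ ℓ → ∃ Q : DGModule R B,
    Nonempty (SubquotModSpec he (filt ℓ) (filt (ℓ + 1)) Q) ∧ HasFiniteSemifreeBasis Q

/-- A DG `A`-submodule of a DG `A`-module `M`: an `R`-submodule closed under the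
`A`-action and the differential and generated by homogeneous elements. -/
structure DGSubmodule {A : DGAlgebra R} (M : DGModule R A) where
  toSubmodule : Submodule R M.carrier
  smul_mem' : ∀ (x : M.carrier) (a : A.carrier), x ∈ toSubmodule →
    M.smul x a ∈ toSubmodule
  d_mem' : ∀ x ∈ toSubmodule, M.d x ∈ toSubmodule
  graded' : ∀ x ∈ toSubmodule, x ∈ Submodule.span R
    ((toSubmodule : Set M.carrier) ∩ ⋃ i : ℤ, (M.grading i : Set M.carrier))

/-- `P` (with projections `proj`) is the direct product of the family `Ms` in the
category of DG `A`-modules. -/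
def IsDGProduct {A : DGAlgebra R} (Ms : ℕ → DGModule R A) (P : DGModule R A)
    (proj : ∀ ℓ, DGHom P (Ms ℓ)) : Prop :=
  ∀ (W : DGModule R A) (f : ∀ ℓ, DGHom W (Ms ℓ)),
    ∃ g : DGHom W P, (∀ ℓ x, (proj ℓ).toFun (g.toFun x) = (f ℓ).toFun x) ∧
      ∀ g' : DGHom W P, (∀ ℓ x, (proj ℓ).toFun (g'.toFun x) = (f ℓ).toFun x) →
        ∀ x, g'.toFun x = g.toFun x

/-- `M'` is the `k`-th shift `Σ^k M` of the DG `A`-module `M`. -/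
structure DGShiftSpec {A : DGAlgebra R} (k : ℤ) (M M' : DGModule R A) where
  toFun : M.carrier → M'.carrier
  bij : Function.Bijective toFun
  map_add : ∀ x y, toFun (x + y) = toFun x + toFun y
  map_rsmul : ∀ (r : R) x, toFun (r • x) = r • toFun x
  map_mem : ∀ {i : ℤ} (x : M.carrier), x ∈ M.grading i → toFun x ∈ M'.grading (i + k)
  map_smul : ∀ (x : M.carrier) (a : A.carrier), toFun (M.smul x a) = M'.smul (toFun x) a
  map_d : ∀ x, M'.d (toFun x) = ksign k • toFun (M.d x)

/-- `C` is the mapping cone of `f : X → Y`: a degreewise split extension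
`0 → Y → C → ΣX → 0` whose twisting term is `f`. -/
structure DGConeSpec {A : DGAlgebra R} {X Y : DGModule R A} (f : DGHom X Y)
    (C : DGModule R A) where
  inl : DGHom Y C
  inl_inj : Function.Injective inl.toFun
  pr : GradedHom C X (-1)
  pr_d : ∀ c, pr.toFun (C.d c) = - X.d (pr.toFun c)
  sec : GradedHom X C 1
  pr_sec : ∀ x, pr.toFun (sec.toFun x) = x
  pr_inl : ∀ y, pr.toFun (inl.toFun y) = 0
  split : ∀ c, ∃ y, c = inl.toFun y + sec.toFun (pr.toFun c)
  sec_d : ∀ x, C.d (sec.toFun x) = - sec.toFun (X.d x) + inl.toFun (f.toFun x)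

/-- A system of divided powers on (the homogeneous elements of positive even degree
of) a DG `R`-algebra. -/
structure DGDividedPowers (A : DGAlgebra R) where
  dpow : ℕ → A.carrier → A.carrier
  dpow_zero : ∀ {i : ℤ} (u : A.carrier), 0 < i → Even i → u ∈ A.grading i →
    dpow 0 u = 1
  dpow_one : ∀ {i : ℤ} (u : A.carrier), 0 < i → Even i → u ∈ A.grading i →
    dpow 1 u = u
  dpow_mem : ∀ {i : ℤ} (u : A.carrier) (m : ℕ), 0 < i → Even i → u ∈ A.grading i →
    dpow m u ∈ A.grading ((m : ℤ) * i)
  dpow_mul : ∀ {i : ℤ} (u : A.carrier) (m l : ℕ), 0 < i → Even i → u ∈ A.grading i →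
    dpow m u * dpow l u = ((m + l).choose m : ℤ) • dpow (m + l) u
  dpow_add : ∀ {i : ℤ} (u v : A.carrier) (m : ℕ), 0 < i → Even i →
    u ∈ A.grading i → v ∈ A.grading i →
    dpow m (u + v) = ∑ j ∈ Finset.range (m + 1), dpow j u * dpow (m - j) v
  dpow_odd_mul : ∀ {i j : ℤ} (u v : A.carrier) (m : ℕ), Odd i → Odd j →
    u ∈ A.grading i → v ∈ A.grading j → 2 ≤ m → dpow m (u * v) = 0
  dpow_even_mul : ∀ {i j : ℤ} (u v : A.carrier) (m : ℕ), Even i → Even j → 0 < j →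
    u ∈ A.grading i → v ∈ A.grading j → dpow m (u * v) = u ^ m * dpow m v
  dpow_comp : ∀ {i : ℤ} (u : A.carrier) (m l : ℕ), 0 < i → Even i →
    u ∈ A.grading i → 1 ≤ m →
    dpow l (dpow m u) =
      (Nat.factorial (m * l) / (Nat.factorial l * (Nat.factorial m) ^ l)) •
        dpow (m * l) u

/-- The index set of monomials in variables `ι` (with divided/ordinary powers):
finitely supported exponent functions, with exponents at most `1` on odd-degree
variables. -/
def MonIdx (ι : Type) (degX : ι → ℤ) : Type :=
  {m : ι →₀ ℕ // ∀ i, Odd (degX i) → m i ≤ 1}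

/-- Total weight (number of symbols) of a monomial index. -/
def monWeight {ι : Type} {degX : ι → ℤ} (m : MonIdx ι degX) : ℕ :=
  m.1.sum fun _ k => k

/-- The monomial `∏_i g i (m i)` (product taken in the increasing order of the
variables). -/
def gradMonomial {T : Type} [Ring T] {ι : Type} [LinearOrder ι] (degX : ι → ℤ)
    (g : ι → ℕ → T) (m : MonIdx ι degX) : T :=
  ((m.1.support.sort (· ≤ ·)).map fun i => g i (m.1 i)).prod

/-- `B = A[X_i : i ∈ ι]` is a polynomial extension of `A` by the variables `X_i`
of positive degrees `degX i`, adjoined in increasing order of degree, each `d X_i`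
lying in the preceding stage; the monomials in the `X_i` form a basis of `B` as a
graded `A`-module. -/
structure PolyExt {A B : DGAlgebra R} (φ : DGAlgHom A B) (ι : Type) [LinearOrder ι]
    (X : ι → B.carrier) (degX : ι → ℤ) where
  inj : Function.Injective φ.toFun
  pos_deg : ∀ i, 0 < degX i
  mono_deg : Monotone degX
  homog : ∀ i, X i ∈ B.grading (degX i)
  d_prev : ∀ i : ι, ∃ c : MonIdx ι degX →₀ A.carrier,
    (∀ m ∈ c.support, ∀ j : ι, i ≤ j → m.1 j = 0) ∧
    B.d (X i) = c.sum fun m a =>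
      gradMonomial degX (fun i' k => X i' ^ k) m * φ.toFun a
  basis : Function.Bijective (fun c : MonIdx ι degX →₀ A.carrier =>
    c.sum fun m a => gradMonomial degX (fun i' k => X i' ^ k) m * φ.toFun a)

/-- `B = A⟨X_i : i ∈ ι⟩` is a free (divided power) extension of `A` by the
variables `X_i` of positive degrees: odd variables square to zero, even variables
carry divided powers `dp i m` with `d(X^{(m)}) = X^{(m-1)} dX`, and the divided
power monomials form a basis of `B` as a graded `A`-module. -/
structure FreeExt {A B : DGAlgebra R} (φ : DGAlgHom A B) (ι : Type) [LinearOrder ι]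
    (X : ι → B.carrier) (degX : ι → ℤ) where
  inj : Function.Injective φ.toFun
  pos_deg : ∀ i, 0 < degX i
  mono_deg : Monotone degX
  homog : ∀ i, X i ∈ B.grading (degX i)
  dp : ι → ℕ → B.carrier
  dp_zero : ∀ i, dp i 0 = 1
  dp_one : ∀ i, dp i 1 = X i
  dp_odd : ∀ i m, Odd (degX i) → 2 ≤ m → dp i m = 0
  dp_mem : ∀ i (m : ℕ), dp i m ∈ B.grading ((m : ℤ) * degX i)
  dp_mul : ∀ i (m l : ℕ), dp i m * dp i l = ((m + l).choose m : ℤ) • dp i (m + l)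
  dp_d : ∀ i (m : ℕ), 1 ≤ m → B.d (dp i m) = dp i (m - 1) * B.d (X i)
  d_prev : ∀ i : ι, ∃ c : MonIdx ι degX →₀ A.carrier,
    (∀ m ∈ c.support, ∀ j : ι, i ≤ j → m.1 j = 0) ∧
    B.d (X i) = c.sum fun m a => gradMonomial degX dp m * φ.toFun a
  basis : Function.Bijective (fun c : MonIdx ι degX →₀ A.carrier =>
    c.sum fun m a => gradMonomial degX dp m * φ.toFun a)

/-- The diagonal `ξ_i = X_i^o ⊗ 1 - 1^o ⊗ X_i` of the variable `X_i` in `B^e`. -/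
def xiDiag {A B E : DGAlgebra R} {φ : DGAlgHom A B} (he : EnvelopingAlg φ E)
    {ι : Type} (X : ι → B.carrier) (i : ι) : E.carrier :=
  he.l.toFun (X i) - he.r.toFun (X i)

/-- The divided powers `ξ_i^{(m)} = Σ_{j=0}^m (-1)^{m-j} (X_i^{(j)})^o ⊗ X_i^{(m-j)}`
of the diagonal `ξ_i` in `B^e` (zero for `m ≥ 2` when `|X_i|` is odd). -/
def xiDp {A B E : DGAlgebra R} {φ : DGAlgHom A B} (he : EnvelopingAlg φ E)
    {ι : Type} (dp : ι → ℕ → B.carrier) (degX : ι → ℤ) (i : ι) (m : ℕ) :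
    E.carrier :=
  if Odd (degX i) ∧ 2 ≤ m then 0
  else ∑ j ∈ Finset.range (m + 1),
    ((-1 : ℤ) ^ (m - j)) • (he.l.toFun (dp i j) * he.r.toFun (dp i (m - j)))

/-- The monomial `ξ^{(m)} = ξ_{i_1}^{(m_{i_1})} ⋯ ξ_{i_t}^{(m_{i_t})}` in `B^e`
built from the divided powers of the diagonals. -/
def FreeExt.diagMon {A B E : DGAlgebra R} {φ : DGAlgHom A B}
    {ι : Type} [LinearOrder ι] {X : ι → B.carrier} {degX : ι → ℤ}
    (fe : FreeExt φ ι X degX) (he : EnvelopingAlg φ E) (m : MonIdx ι degX) :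
    E.carrier :=
  gradMonomial degX (xiDp he fe.dp degX) m

/-- The `ℓ`-th power `J^{(ℓ)} = Mon_{≥ℓ}(Ω)·B^e` of the diagonal ideal:
right `B^e`-linear combinations of the `ξ`-monomials of weight at least `ℓ`. -/
def FreeExt.diagPow {A B E : DGAlgebra R} {φ : DGAlgHom A B}
    {ι : Type} [LinearOrder ι] {X : ι → B.carrier} {degX : ι → ℤ}
    (fe : FreeExt φ ι X degX) (he : EnvelopingAlg φ E) (ℓ : ℕ) :
    Set E.carrier :=
  {x | ∃ c : MonIdx ι degX →₀ E.carrier, (∀ m ∈ c.support, ℓ ≤ monWeight m) ∧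
    x = c.sum fun m e => fe.diagMon he m * e}

/-- Ordinary-power analogue `J^ℓ` for polynomial extensions. -/
def PolyExt.diagPow {A B E : DGAlgebra R} {φ : DGAlgHom A B}
    {ι : Type} [LinearOrder ι] {X : ι → B.carrier} {degX : ι → ℤ}
    (_ : PolyExt φ ι X degX) (he : EnvelopingAlg φ E) (ℓ : ℕ) :
    Set E.carrier :=
  {x | ∃ c : MonIdx ι degX →₀ E.carrier, (∀ m ∈ c.support, ℓ ≤ monWeight m) ∧
    x = c.sum fun m e =>
      gradMonomial degX (fun i k => (xiDiag he X i) ^ k) m * e}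

/-- Additive closure of the set of products `a * b` with `a ∈ S₁`, `b ∈ S₂`. -/
def setMulClosure {T : Type} [Ring T] (S₁ S₂ : Set T) : Set T :=
  (AddSubmonoid.closure {x | ∃ a ∈ S₁, ∃ b ∈ S₂, x = a * b} : AddSubmonoid T)

/-- The right ideal generated by a set. -/
def rightIdealGen {T : Type} [Ring T] (S : Set T) : Set T :=
  (AddSubmonoid.closure {x | ∃ s ∈ S, ∃ e : T, x = s * e} : AddSubmonoid T)

/-- The two-sided ideal generated by a set. -/
def twoSidedGen {T : Type} [Ring T] (S : Set T) : Set T :=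
  (AddSubmonoid.closure {x | ∃ s ∈ S, ∃ e e' : T, x = e * s * e'} : AddSubmonoid T)

end

noncomputable section

namespace NaiveLift

open scoped DirectSum TensorProduct

section Sign

theorem ksign_eq_ite (i : ℤ) : ksign i = if Even i then 1 else -1 := by
  unfold ksign
  split_ifs with h
  · rw [h.neg_one_zpow]; rfl
  · rw [(Int.not_even_iff_odd.1 h).neg_one_zpow]; rfl

theorem ksign_add (i j : ℤ) : ksign (i + j) = ksign i * ksign j := by
  simp only [ksign_eq_ite, Int.even_add]
  by_cases hi : Even i <;> by_cases hj : Even j <;> simp [hi, hj]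

theorem ksign_zero : ksign 0 = 1 := by simp [ksign_eq_ite]

theorem ksign_mul_self (i : ℤ) : ksign i * ksign i = 1 := by
  rw [ksign_eq_ite]; split_ifs <;> simp

theorem ksign_smul_smul {M : Type} [AddCommGroup M] (i : ℤ) (x : M) :
    ksign i • ksign i • x = x := by
  rw [smul_smul, ksign_mul_self, one_smul]

end Sign

section Graded

variable {R M P : Type} [CommRing R] [AddCommGroup M] [Module R M] [AddCommGroup P] [Module R P]
  (G : ℤ → Submodule R M)

/-- A decomposition obtained from independence and spanning of the graded pieces. -/
abbrev decompositionOf (h₁ : ∀ i : ℤ, Disjoint (G i) (⨆ j ≠ i, G j)) (h₂ : (⨆ i, G i) = ⊤) :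
    DirectSum.Decomposition G :=
  ((DirectSum.isInternal_submodule_iff_iSupIndep_and_iSup_eq_top G).2
    ⟨h₁, h₂⟩).chooseDecomposition

/-- A family of projections onto submodules makes them independent. -/
theorem disjoint_of_proj (pr : ℤ → M →ₗ[R] M) (same : ∀ i, ∀ x ∈ G i, pr i x = x)
    (ne : ∀ i j, j ≠ i → ∀ x ∈ G j, pr i x = 0) (i : ℤ) :
    Disjoint (G i) (⨆ j ≠ i, G j) := by
  rw [Submodule.disjoint_def]
  intro x hx hx'
  have hle : (⨆ j ≠ i, G j) ≤ LinearMap.ker (pr i) :=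
    iSup₂_le fun j hj y hy => ne i j hj y hy
  rw [← same i x hx]
  exact hle hx'

variable [DirectSum.Decomposition G]

/-- The linear map given by a family of linear maps on the graded pieces. -/
def gradedExt (f : ∀ i : ℤ, G i →ₗ[R] P) : M →ₗ[R] P :=
  DirectSum.toModule R ℤ P f ∘ₗ (DirectSum.decomposeLinearEquiv G).toLinearMap

theorem gradedExt_apply (f : ∀ i : ℤ, G i →ₗ[R] P) {i : ℤ} {x : M} (hx : x ∈ G i) :
    gradedExt G f x = f i ⟨x, hx⟩ := by
  simp only [gradedExt, LinearMap.comp_apply, LinearEquiv.coe_coe,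
    DirectSum.decomposeLinearEquiv_apply, DirectSum.decompose_of_mem G hx]
  exact DirectSum.toModule_lof R i _

theorem hom_ext_graded {f g : M →ₗ[R] P} (h : ∀ i, ∀ x ∈ G i, f x = g x) : f = g := by
  ext x
  induction x using DirectSum.Decomposition.inductionOn G with
  | zero => simp
  | homogeneous x => exact h _ _ x.2
  | add x y hx hy => rw [map_add, map_add, hx, hy]

/-- The projection onto the component of degree `k`. -/
def gradedProj (k : ℤ) : M →ₗ[R] M :=
  gradedExt G fun i => if i = k then (G i).subtype else 0

theorem gradedProj_same {k : ℤ} {x : M} (hx : x ∈ G k) : gradedProj G k x = x := by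
  simp [gradedProj, gradedExt_apply G _ hx]

theorem gradedProj_ne {k i : ℤ} (hik : i ≠ k) {x : M} (hx : x ∈ G i) : gradedProj G k x = 0 := by
  simp [gradedProj, gradedExt_apply G _ hx, hik]

theorem gradedProj_mem (k : ℤ) (x : M) : gradedProj G k x ∈ G k := by
  induction x using DirectSum.Decomposition.inductionOn G with
  | zero => simp
  | @homogeneous i x =>
    by_cases h : i = k
    · subst h; rw [gradedProj_same G x.2]; exact x.2
    · rw [gradedProj_ne G h x.2]; exact zero_mem _
  | add x y hx hy => rw [map_add]; exact add_mem hx hy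

/-- The Koszul twist `x ↦ (-1)^{k|x|} x`. -/
def twist (k : ℤ) : M →ₗ[R] M :=
  gradedExt G fun i => ksign (k * i) • (G i).subtype

theorem twist_apply (k : ℤ) {i : ℤ} {x : M} (hx : x ∈ G i) :
    twist G k x = ksign (k * i) • x := by
  simp [twist, gradedExt_apply G _ hx]

theorem twist_twist (k : ℤ) (x : M) : twist G k (twist G k x) = x := by
  have : twist G k ∘ₗ twist G k = LinearMap.id := hom_ext_graded G fun i x hx => by
    simp [twist_apply G k hx, ksign_smul_smul]
  exact LinearMap.congr_fun this x

/-- A linear map which has degree `k` on a spanning set of homogeneous elements has degree `k`. -/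
theorem map_mem_of_span (H : ℤ → Submodule R P) [DirectSum.Decomposition H] (f : M →ₗ[R] P) (k : ℤ)
    (h : Submodule.span R {x : M | ∃ i, x ∈ G i ∧ f x ∈ H (i + k)} = ⊤) {i : ℤ} {x : M}
    (hx : x ∈ G i) : f x ∈ H (i + k) := by
  have key : f ∘ₗ gradedProj G i = gradedProj H (i + k) ∘ₗ f := by
    apply LinearMap.ext_on h
    rintro y ⟨j, hy, hfy⟩
    simp only [LinearMap.comp_apply]
    by_cases hj : j = i
    · subst hj; rw [gradedProj_same G hy, gradedProj_same H hfy]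
    · rw [gradedProj_ne G hj hy, gradedProj_ne H (by omega) hfy, map_zero]
  have := LinearMap.congr_fun key x
  simp only [LinearMap.comp_apply, gradedProj_same G hx] at this
  rw [this]
  exact gradedProj_mem H _ _

end Graded

section

variable {R : Type} [CommRing R] {A B : DGAlgebra R}

instance (A : DGAlgebra R) : DirectSum.Decomposition A.grading :=
  decompositionOf _ A.indep A.spanning

instance (N : DGModule R A) : DirectSum.Decomposition N.grading :=
  decompositionOf _ N.indep N.spanning

/-- The differential of a DG algebra as a linear map. -/
def algD (A : DGAlgebra R) : A.carrier →ₗ[R] A.carrier where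
  toFun := A.d
  map_add' := A.d_add
  map_smul' := A.d_rsmul

/-- The differential of a DG module as a linear map. -/
def modD (N : DGModule R A) : N.carrier →ₗ[R] N.carrier where
  toFun := N.d
  map_add' := N.d_add
  map_smul' := N.d_rsmul

/-- The action of a DG algebra on a DG module as a bilinear map. -/
def act (N : DGModule R A) : N.carrier →ₗ[R] A.carrier →ₗ[R] N.carrier :=
  LinearMap.mk₂ R N.smul N.add_smul N.rsmul_smul N.smul_add N.smul_rsmul

/-- The linear map underlying a homomorphism of DG algebras. -/
def algLin (φ : DGAlgHom A B) : A.carrier →ₗ[R] B.carrier where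
  toFun := φ.toFun
  map_add' := φ.map_add
  map_smul' := φ.map_rsmul

/-- The linear map underlying a homomorphism of DG modules. -/
def homLin {N W : DGModule R A} (f : DGHom N W) : N.carrier →ₗ[R] W.carrier where
  toFun := f.toFun
  map_add' := f.map_add
  map_smul' := f.map_rsmul

/-- The linear map underlying a graded homomorphism of DG modules. -/
def gradedLin {N W : DGModule R A} {k : ℤ} (f : GradedHom N W k) : N.carrier →ₗ[R] W.carrier where
  toFun := f.toFun
  map_add' := f.map_add
  map_smul' := f.map_rsmul

@[simp] theorem algD_apply (A : DGAlgebra R) (a : A.carrier) : algD A a = A.d a := rfl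
@[simp] theorem modD_apply (N : DGModule R A) (x : N.carrier) : modD N x = N.d x := rfl
@[simp] theorem act_apply (N : DGModule R A) (x : N.carrier) (a : A.carrier) :
    act N x a = N.smul x a := rfl
@[simp] theorem algLin_apply (φ : DGAlgHom A B) (a : A.carrier) : algLin φ a = φ.toFun a := rfl
@[simp] theorem homLin_apply {N W : DGModule R A} (f : DGHom N W) (x : N.carrier) :
    homLin f x = f.toFun x := rfl
@[simp] theorem gradedLin_apply {N W : DGModule R A} {k : ℤ} (f : GradedHom N W k)
    (x : N.carrier) : gradedLin f x = f.toFun x := rfl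

theorem smul_zsmul_left (N : DGModule R A) (k : ℤ) (x : N.carrier) (a : A.carrier) :
    N.smul (k • x) a = k • N.smul x a := by
  rw [← act_apply, map_zsmul, LinearMap.smul_apply, act_apply]

theorem smul_zsmul_right (N : DGModule R A) (k : ℤ) (x : N.carrier) (a : A.carrier) :
    N.smul x (k • a) = k • N.smul x a := by
  rw [← act_apply, map_zsmul, act_apply]

theorem modD_zsmul (N : DGModule R A) (k : ℤ) (x : N.carrier) : N.d (k • x) = k • N.d x := by
  rw [← modD_apply, map_zsmul, modD_apply]

section Induced

variable (φ : DGAlgHom A B) (N : DGModule R B)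

/-- The relations defining `N|_A ⊗_A B` as a quotient of `N ⊗_R B`. -/
def indRel : Submodule R (N.carrier ⊗[R] B.carrier) :=
  Submodule.span R {t | ∃ (x : N.carrier) (a : A.carrier) (b : B.carrier),
    t = N.smul x (φ.toFun a) ⊗ₜ[R] b - x ⊗ₜ[R] (φ.toFun a * b)}

/-- The underlying module of `N|_A ⊗_A B`. -/
def Ind : Type := (N.carrier ⊗[R] B.carrier) ⧸ indRel φ N

instance : AddCommGroup (Ind φ N) :=
  inferInstanceAs (AddCommGroup ((N.carrier ⊗[R] B.carrier) ⧸ indRel φ N))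

instance : Module R (Ind φ N) :=
  inferInstanceAs (Module R ((N.carrier ⊗[R] B.carrier) ⧸ indRel φ N))

/-- The pure tensors of `N|_A ⊗_A B`. -/
def tmk : N.carrier →ₗ[R] B.carrier →ₗ[R] Ind φ N :=
  (TensorProduct.mk R N.carrier B.carrier).compr₂
    (show (N.carrier ⊗[R] B.carrier) →ₗ[R] Ind φ N from (indRel φ N).mkQ)

theorem tmk_balanced (x : N.carrier) (a : A.carrier) (b : B.carrier) :
    tmk φ N (N.smul x (φ.toFun a)) b = tmk φ N x (φ.toFun a * b) :=
  (Submodule.Quotient.eq _).2 (Submodule.subset_span ⟨x, a, b, rfl⟩)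

variable {φ N} {P : Type} [AddCommGroup P] [Module R P]

theorem balanced_of_homogeneous {f : N.carrier →ₗ[R] B.carrier →ₗ[R] P}
    (hf : ∀ i j k x a b, x ∈ N.grading i → a ∈ A.grading j → b ∈ B.grading k →
      f (N.smul x (φ.toFun a)) b = f x (φ.toFun a * b)) (x : N.carrier) (a : A.carrier)
    (b : B.carrier) : f (N.smul x (φ.toFun a)) b = f x (φ.toFun a * b) := by
  induction x using DirectSum.Decomposition.inductionOn N.grading with
  | zero => rw [← act_apply, map_zero]; simp
  | add x y hx hy => rw [← act_apply, map_add, LinearMap.add_apply, map_add, map_add,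
      LinearMap.add_apply, LinearMap.add_apply, act_apply, act_apply, hx, hy]
  | homogeneous x =>
  induction a using DirectSum.Decomposition.inductionOn A.grading with
  | zero => rw [← act_apply, ← algLin_apply, map_zero, map_zero]; simp
  | add a a' ha ha' =>
    rw [φ.map_add, N.smul_add, map_add, LinearMap.add_apply, ha, ha', add_mul, map_add]
  | homogeneous a =>
  induction b using DirectSum.Decomposition.inductionOn B.grading with
  | zero => simp
  | add b b' hb hb' => rw [map_add, hb, hb', mul_add, map_add]
  | homogeneous b => exact hf _ _ _ _ _ _ x.2 a.2 b.2

/-- The linear map out of `N|_A ⊗_A B` given by a balanced bilinear map. -/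
def tlift (f : N.carrier →ₗ[R] B.carrier →ₗ[R] P)
    (hf : ∀ i j k x a b, x ∈ N.grading i → a ∈ A.grading j → b ∈ B.grading k →
      f (N.smul x (φ.toFun a)) b = f x (φ.toFun a * b)) : Ind φ N →ₗ[R] P :=
  (indRel φ N).liftQ (TensorProduct.lift f) <| by
    rw [indRel, Submodule.span_le]
    rintro _ ⟨x, a, b, rfl⟩
    simp [balanced_of_homogeneous hf x a b]

@[simp] theorem tlift_tmk (f : N.carrier →ₗ[R] B.carrier →ₗ[R] P) (hf) (x : N.carrier)
    (b : B.carrier) : tlift (φ := φ) f hf (tmk φ N x b) = f x b := rfl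

theorem ind_hom_ext {f g : Ind φ N →ₗ[R] P}
    (h : ∀ i j x b, x ∈ N.grading i → b ∈ B.grading j → f (tmk φ N x b) = g (tmk φ N x b)) :
    f = g := by
  have h' : (tmk φ N).compr₂ f = (tmk φ N).compr₂ g :=
    hom_ext_graded N.grading fun i x hx => hom_ext_graded B.grading fun j b hb => h i j x b hx hb
  apply Submodule.linearMap_qext
  apply TensorProduct.ext
  exact h'

variable (φ N)

/-- The grading of `N|_A ⊗_A B`. -/
def indGrading (k : ℤ) : Submodule R (Ind φ N) :=
  Submodule.span R {t | ∃ i j x b, x ∈ N.grading i ∧ b ∈ B.grading j ∧ i + j = k ∧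
    t = tmk φ N x b}

variable {φ N} in
theorem tmk_mem {i j : ℤ} {x : N.carrier} {b : B.carrier} (hx : x ∈ N.grading i)
    (hb : b ∈ B.grading j) : tmk φ N x b ∈ indGrading φ N (i + j) :=
  Submodule.subset_span ⟨i, j, x, b, hx, hb, rfl, rfl⟩

variable {φ N} in
theorem map_mem_of_tmk (H : ℤ → Submodule R P) (f : Ind φ N →ₗ[R] P) (l : ℤ)
    (h : ∀ i j x b, x ∈ N.grading i → b ∈ B.grading j → f (tmk φ N x b) ∈ H (i + j + l)) {k : ℤ}
    {t : Ind φ N} (ht : t ∈ indGrading φ N k) : f t ∈ H (k + l) := by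
  have : indGrading φ N k ≤ (H (k + l)).comap f := by
    rw [indGrading, Submodule.span_le]
    rintro _ ⟨i, j, x, b, hx, hb, rfl, rfl⟩
    exact h i j x b hx hb
  exact this ht

theorem iSup_indGrading : (⨆ k, indGrading φ N k) = ⊤ := by
  have h : (⨆ k, indGrading φ N k).mkQ = 0 := ind_hom_ext fun i j x b hx hb => by
    rw [LinearMap.zero_apply, Submodule.mkQ_apply, Submodule.Quotient.mk_eq_zero]
    exact Submodule.mem_iSup_of_mem _ (tmk_mem hx hb)
  rw [← Submodule.ker_mkQ (⨆ k, indGrading φ N k), h, LinearMap.ker_zero]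

theorem alg_map_mem_mul {j k : ℤ} {a : A.carrier} {b : B.carrier} (ha : a ∈ A.grading j)
    (hb : b ∈ B.grading k) : φ.toFun a * b ∈ B.grading (j + k) :=
  B.mul_mem (φ.map_mem ha) hb

theorem act_map_mem {i j : ℤ} {x : N.carrier} {a : A.carrier} (hx : x ∈ N.grading i)
    (ha : a ∈ A.grading j) : N.smul x (φ.toFun a) ∈ N.grading (i + j) :=
  N.smul_mem hx (φ.map_mem ha)

/-- The projection of `N|_A ⊗_A B` onto its component of degree `k`. -/
def indProj (k : ℤ) : Ind φ N →ₗ[R] Ind φ N :=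
  tlift (gradedExt N.grading fun i =>
      ((tmk φ N).compl₂ (gradedProj B.grading (k - i))) ∘ₗ (N.grading i).subtype) <| by
    intro i j l x a b hx ha hb
    rw [gradedExt_apply _ _ (act_map_mem φ N hx ha), gradedExt_apply _ _ hx]
    simp only [LinearMap.comp_apply, Submodule.subtype_apply, LinearMap.compl₂_apply]
    by_cases h : l = k - (i + j)
    · rw [gradedProj_same _ (h ▸ hb), gradedProj_same, tmk_balanced]
      rw [show k - i = j + l by omega]
      exact alg_map_mem_mul φ ha hb
    · rw [gradedProj_ne _ h hb, gradedProj_ne _ _ (alg_map_mem_mul φ ha hb)]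
      · simp
      · omega

theorem indProj_tmk (k : ℤ) {i j : ℤ} {x : N.carrier} {b : B.carrier} (hx : x ∈ N.grading i)
    (hb : b ∈ B.grading j) :
    indProj φ N k (tmk φ N x b) = if i + j = k then tmk φ N x b else 0 := by
  rw [indProj, tlift_tmk, gradedExt_apply _ _ hx]
  simp only [LinearMap.comp_apply, Submodule.subtype_apply, LinearMap.compl₂_apply]
  split_ifs with h
  · rw [gradedProj_same]; rwa [show k - i = j by omega]
  · rw [gradedProj_ne _ _ hb, map_zero]; omega

theorem indGrading_disjoint (i : ℤ) :
    Disjoint (indGrading φ N i) (⨆ j ≠ i, indGrading φ N j) := by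
  refine disjoint_of_proj _ (indProj φ N) (fun k t ht => ?_) (fun k l hlk t ht => ?_) i
  · have : indGrading φ N k ≤ LinearMap.eqLocus (indProj φ N k) LinearMap.id := by
      rw [indGrading, Submodule.span_le]
      rintro _ ⟨i, j, x, b, hx, hb, rfl, rfl⟩
      simp [indProj_tmk φ N _ hx hb]
    exact this ht
  · have : indGrading φ N l ≤ LinearMap.ker (indProj φ N k) := by
      rw [indGrading, Submodule.span_le]
      rintro _ ⟨i, j, x, b, hx, hb, rfl, rfl⟩
      simp [indProj_tmk φ N _ hx hb, hlk]
    exact this ht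

/-- The differential of `N|_A ⊗_A B`. -/
def indD : Ind φ N →ₗ[R] Ind φ N :=
  tlift ((tmk φ N) ∘ₗ modD N + ((tmk φ N).compl₂ (algD B)) ∘ₗ twist N.grading 1) <| by
    intro i j l x a b hx ha hb
    simp only [LinearMap.add_apply, LinearMap.comp_apply, LinearMap.compl₂_apply,
      twist_apply _ _ hx, twist_apply _ _ (act_map_mem φ N hx ha), modD_apply, algD_apply,
      N.leibniz _ _ hx, B.leibniz _ _ (φ.map_mem ha), one_mul, map_add, map_zsmul,
      LinearMap.smul_apply, ← φ.comm_d, tmk_balanced, ksign_add, smul_add, smul_smul, add_assoc]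

theorem indD_tmk {i : ℤ} {x : N.carrier} (hx : x ∈ N.grading i) (b : B.carrier) :
    indD φ N (tmk φ N x b) = tmk φ N (N.d x) b + ksign i • tmk φ N x (B.d b) := by
  simp [indD, twist_apply _ _ hx]

/-- The right action of `b` on `N|_A ⊗_A B`. -/
def indAct (b : B.carrier) : Ind φ N →ₗ[R] Ind φ N :=
  tlift ((tmk φ N).compl₂ (LinearMap.mulRight R b)) <| by
    intro i j l x a c hx ha hc
    simp [tmk_balanced, mul_assoc]

@[simp] theorem indAct_tmk (b : B.carrier) (x : N.carrier) (c : B.carrier) :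
    indAct φ N b (tmk φ N x c) = tmk φ N x (c * b) := rfl

/-- The DG module `N|_A ⊗_A B`. -/
abbrev indModule : DGModule R B where
  carrier := Ind φ N
  grading := indGrading φ N
  indep := indGrading_disjoint φ N
  spanning := iSup_indGrading φ N
  smul t b := indAct φ N b t
  smul_add t b c := by
    have : indAct φ N (b + c) = indAct φ N b + indAct φ N c :=
      ind_hom_ext fun i j x b hx hb => by simp [mul_add]
    rw [this, LinearMap.add_apply]
  add_smul t t' b := map_add _ _ _
  smul_rsmul r t b := by
    have : indAct φ N (r • b) = r • indAct φ N b :=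
      ind_hom_ext fun i j x b hx hb => by simp
    rw [this, LinearMap.smul_apply]
  rsmul_smul r t b := map_smul _ _ _
  smul_one t := by
    have : indAct φ N 1 = LinearMap.id := ind_hom_ext fun i j x b hx hb => by simp
    rw [this, LinearMap.id_apply]
  smul_mul t b c := by
    have : indAct φ N c ∘ₗ indAct φ N b = indAct φ N (b * c) :=
      ind_hom_ext fun i j x b hx hb => by simp [mul_assoc]
    exact LinearMap.congr_fun this t
  smul_mem {k l t b} ht hb := map_mem_of_tmk (indGrading φ N) (indAct φ N b) l
    (fun i j x c hx hc => by
      rw [indAct_tmk, add_assoc]; exact tmk_mem hx (B.mul_mem hc hb)) ht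
  d := indD φ N
  d_add := map_add _
  d_rsmul := map_smul _
  d_mem {k t} ht := map_mem_of_tmk (indGrading φ N) (indD φ N) (-1)
    (fun i j x c hx hc => by
      rw [indD_tmk φ N hx]
      refine add_mem ?_ (zsmul_mem ?_ _)
      · rw [show i + j + -1 = i - 1 + j by ring]; exact tmk_mem (N.d_mem hx) hc
      · rw [show i + j + -1 = i + (j - 1) by ring]; exact tmk_mem hx (B.d_mem hc)) ht
  d_sq t := by
    have : indD φ N ∘ₗ indD φ N = 0 := ind_hom_ext fun i j x b hx hb => by
      simp only [LinearMap.comp_apply, indD_tmk φ N hx, map_add, map_zsmul,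
        indD_tmk φ N (N.d_mem hx), N.d_sq, B.d_sq, map_zero, LinearMap.zero_apply]
      rw [sub_eq_add_neg, ksign_add]
      simp [ksign_eq_ite (-1)]
    exact LinearMap.congr_fun this t
  leibniz {k} t b ht := by
    have : indGrading φ N k ≤ LinearMap.eqLocus (indD φ N ∘ₗ indAct φ N b)
        (indAct φ N b ∘ₗ indD φ N + ksign k • indAct φ N (B.d b)) := by
      rw [indGrading, Submodule.span_le]
      rintro _ ⟨i, j, x, c, hx, hc, rfl, rfl⟩
      simp only [SetLike.mem_coe, LinearMap.mem_eqLocus, LinearMap.comp_apply, indAct_tmk,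
        indD_tmk φ N hx, B.leibniz _ _ hc, map_add, map_zsmul, LinearMap.add_apply,
        LinearMap.smul_apply, ksign_add, smul_add, smul_smul, add_assoc]
    exact this ht

end Induced

end

section

variable {R : Type} [CommRing R] {A B : DGAlgebra R} (φ : DGAlgHom A B) (N : DGModule R B)

/-- The left action `b · x = (-1)^{|b||x|} x b` of `B` on a right DG `B`-module. -/
def leftAct : B.carrier →ₗ[R] N.carrier →ₗ[R] N.carrier :=
  gradedExt B.grading fun i =>
    (LinearMap.lcomp R _ (twist N.grading i)) ∘ₗ (act N).flip ∘ₗ (B.grading i).subtype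

theorem leftAct_apply {i j : ℤ} {b : B.carrier} {x : N.carrier} (hb : b ∈ B.grading i)
    (hx : x ∈ N.grading j) : leftAct N b x = ksign (i * j) • N.smul x b := by
  simp [leftAct, gradedExt_apply _ _ hb, twist_apply _ _ hx]

theorem leftAct_smul (b c : B.carrier) (x : N.carrier) :
    leftAct N b (N.smul x c) = N.smul (leftAct N b x) c := by
  have : (leftAct N).compr₂ ((act N).flip c) = ((leftAct N).compl₂ ((act N).flip c)) := by
    refine hom_ext_graded B.grading fun i b hb => hom_ext_graded N.grading fun j x hx => ?_
    simp only [LinearMap.compr₂_apply, LinearMap.compl₂_apply, LinearMap.flip_apply, act_apply]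
    induction c using DirectSum.Decomposition.inductionOn B.grading with
    | zero => rw [← act_apply, ← act_apply, map_zero, map_zero, map_zero]
    | add c c' hc hc' => rw [N.smul_add, N.smul_add, hc, hc', map_add]
    | @homogeneous k c =>
      rw [leftAct_apply N hb hx, leftAct_apply N hb (N.smul_mem hx c.2), smul_zsmul_left,
        N.smul_mul, N.smul_mul, B.gcomm _ _ hb c.2, smul_zsmul_right, smul_smul,
        mul_add, ksign_add]
  exact (LinearMap.congr_fun₂ this b x).symm

/-- The bilinear maps underlying the left multiplication by `1 ⊗ b`. -/
def insertAct : B.carrier →ₗ[R] N.carrier →ₗ[R] B.carrier →ₗ[R] Ind φ N :=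
  gradedExt B.grading fun i =>
    { toFun b := ((tmk φ N).compl₂ (LinearMap.mulLeft R (b : B.carrier))) ∘ₗ twist N.grading i
      map_add' b b' := by ext; simp [add_mul]
      map_smul' r b := by ext; simp }

theorem insertAct_apply {i j : ℤ} {b : B.carrier} {x : N.carrier} (hb : b ∈ B.grading i)
    (hx : x ∈ N.grading j) (c : B.carrier) :
    insertAct φ N b x c = ksign (i * j) • tmk φ N x (b * c) := by
  simp [insertAct, gradedExt_apply _ _ hb, twist_apply _ _ hx]

theorem insertAct_balanced (b : B.carrier) (i j k : ℤ) (x : N.carrier) (a : A.carrier)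
    (c : B.carrier) (hx : x ∈ N.grading i) (ha : a ∈ A.grading j) (_ : c ∈ B.grading k) :
    insertAct φ N b (N.smul x (φ.toFun a)) c = insertAct φ N b x (φ.toFun a * c) := by
  induction b using DirectSum.Decomposition.inductionOn B.grading with
  | zero => simp
  | add b b' hb hb' => simp only [map_add, LinearMap.add_apply, hb, hb']
  | homogeneous b =>
    rw [insertAct_apply φ N b.2 hx, insertAct_apply φ N b.2 (act_map_mem φ N hx ha),
      tmk_balanced, ← mul_assoc, ← mul_assoc, B.gcomm _ _ b.2 (φ.map_mem ha), smul_mul_assoc,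
      map_zsmul, smul_smul, mul_add, ksign_add]

/-- Left multiplication by `b ⊗ 1` on `N|_A ⊗_A B`. -/
def lam : B.carrier →ₗ[R] Module.End R (Ind φ N) where
  toFun b := tlift (tmk φ N ∘ₗ leftAct N b) fun i j k x a c hx ha hc => by
    simp [leftAct_smul, tmk_balanced]
  map_add' b b' := ind_hom_ext fun i j x c hx hc => by simp
  map_smul' r b := ind_hom_ext fun i j x c hx hc => by simp

/-- Left multiplication by `1 ⊗ b` on `N|_A ⊗_A B`. -/
def mu : B.carrier →ₗ[R] Module.End R (Ind φ N) where
  toFun b := tlift (insertAct φ N b) (insertAct_balanced φ N b)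
  map_add' b b' := ind_hom_ext fun i j x c hx hc => by simp
  map_smul' r b := ind_hom_ext fun i j x c hx hc => by simp

/-- Left multiplication by `b ⊗ 1 - 1 ⊗ b` on `N|_A ⊗_A B`. -/
def xi : B.carrier →ₗ[R] Module.End R (Ind φ N) := lam φ N - mu φ N

theorem xi_apply (b : B.carrier) : xi φ N b = lam φ N b - mu φ N b := rfl

theorem lam_tmk' (b : B.carrier) (x : N.carrier) (c : B.carrier) :
    lam φ N b (tmk φ N x c) = tmk φ N (leftAct N b x) c := rfl

theorem lam_tmk {i j : ℤ} {b : B.carrier} {x : N.carrier} (hb : b ∈ B.grading i)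
    (hx : x ∈ N.grading j) (c : B.carrier) :
    lam φ N b (tmk φ N x c) = ksign (i * j) • tmk φ N (N.smul x b) c := by
  rw [lam_tmk', leftAct_apply N hb hx, map_zsmul, LinearMap.smul_apply]

theorem mu_tmk {i j : ℤ} {b : B.carrier} {x : N.carrier} (hb : b ∈ B.grading i)
    (hx : x ∈ N.grading j) (c : B.carrier) :
    mu φ N b (tmk φ N x c) = ksign (i * j) • tmk φ N x (b * c) :=
  insertAct_apply φ N hb hx c

theorem alg_hom_ext₂ {P : Type} [AddCommGroup P] [Module R P]
    {f g : B.carrier →ₗ[R] B.carrier →ₗ[R] P}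
    (h : ∀ i j b c, b ∈ B.grading i → c ∈ B.grading j → f b c = g b c) (b c : B.carrier) :
    f b c = g b c := by
  have : f = g := hom_ext_graded B.grading fun i b hb => hom_ext_graded B.grading fun j c hc =>
    h i j b c hb hc
  rw [this]

theorem lam_mul (b c : B.carrier) : lam φ N (b * c) = lam φ N b * lam φ N c := by
  refine alg_hom_ext₂ (f := (LinearMap.mul R B.carrier).compr₂ (lam φ N))
    (g := (LinearMap.mul R (Module.End R (Ind φ N))).compl₁₂ (lam φ N) (lam φ N))
    (fun i j b c hb hc => ind_hom_ext fun k l x e hx he => ?_) b c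
  simp only [LinearMap.compr₂_apply, LinearMap.compl₁₂_apply, LinearMap.mul_apply',
    Module.End.mul_apply]
  rw [lam_tmk φ N (B.mul_mem hb hc) hx, lam_tmk φ N hc hx, map_zsmul,
    lam_tmk φ N hb (N.smul_mem hx hc), N.smul_mul, B.gcomm _ _ hb hc, smul_zsmul_right, map_zsmul,
    LinearMap.smul_apply, smul_smul, smul_smul]
  congr 1
  simp only [add_mul, mul_add, ksign_add]
  ring

theorem mu_mul (b c : B.carrier) : mu φ N (b * c) = mu φ N b * mu φ N c := by
  refine alg_hom_ext₂ (f := (LinearMap.mul R B.carrier).compr₂ (mu φ N))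
    (g := (LinearMap.mul R (Module.End R (Ind φ N))).compl₁₂ (mu φ N) (mu φ N))
    (fun i j b c hb hc => ind_hom_ext fun k l x e hx he => ?_) b c
  simp only [LinearMap.compr₂_apply, LinearMap.compl₁₂_apply, LinearMap.mul_apply',
    Module.End.mul_apply]
  rw [mu_tmk φ N (B.mul_mem hb hc) hx, mu_tmk φ N hc hx, map_zsmul,
    mu_tmk φ N hb hx, smul_smul, mul_assoc, add_mul, ksign_add, mul_comm (ksign _)]

theorem lam_one : lam φ N 1 = 1 := ind_hom_ext fun i j x c hx hc => by
  rw [lam_tmk φ N B.one_mem hx, N.smul_one]; simp [ksign_zero]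

theorem mu_one : mu φ N 1 = 1 := ind_hom_ext fun i j x c hx hc => by
  rw [mu_tmk φ N B.one_mem hx]; simp [ksign_zero]

/-- The left action of the second factor as an algebra homomorphism. -/
def muAlg : B.carrier →ₐ[R] Module.End R (Ind φ N) :=
  AlgHom.ofLinearMap (mu φ N) (mu_one φ N) (mu_mul φ N)

theorem xi_one : xi φ N 1 = 0 := by rw [xi_apply, lam_one, mu_one, sub_self]

theorem xi_mul (b c : B.carrier) :
    xi φ N (b * c) = lam φ N b * xi φ N c + xi φ N b * mu φ N c := by
  simp only [xi_apply, lam_mul, mu_mul, mul_sub, sub_mul]; abel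

theorem xi_map (a : A.carrier) : xi φ N (φ.toFun a) = 0 := by
  have : xi φ N ∘ₗ algLin φ = 0 := hom_ext_graded A.grading fun k a ha =>
    ind_hom_ext fun i j x c hx hc => by
      simp [xi_apply, lam_tmk φ N (φ.map_mem ha) hx, mu_tmk φ N (φ.map_mem ha) hx, tmk_balanced]
  exact LinearMap.congr_fun this a

variable {φ N}

theorem lam_mul_mu {i j : ℤ} {b c : B.carrier} (hb : b ∈ B.grading i) (hc : c ∈ B.grading j) :
    lam φ N b * mu φ N c = ksign (i * j) • (mu φ N c * lam φ N b) :=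
  ind_hom_ext fun k l x e hx he => by
    rw [LinearMap.smul_apply, Module.End.mul_apply, Module.End.mul_apply, mu_tmk φ N hc hx,
      lam_tmk φ N hb hx, map_zsmul, map_zsmul, lam_tmk φ N hb hx, mu_tmk φ N hc (N.smul_mem hx hb),
      smul_smul, smul_smul, smul_smul]
    congr 1
    rw [mul_add, ksign_add, mul_comm j i]
    linear_combination (-ksign (j * k) * ksign (i * k)) * ksign_mul_self (i * j)

theorem mu_mul_lam {i j : ℤ} {b c : B.carrier} (hb : b ∈ B.grading i) (hc : c ∈ B.grading j) :
    mu φ N b * lam φ N c = ksign (i * j) • (lam φ N c * mu φ N b) := by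
  rw [lam_mul_mu hc hb, mul_comm j i, ksign_smul_smul]

theorem lam_mul_lam {i j : ℤ} {b c : B.carrier} (hb : b ∈ B.grading i) (hc : c ∈ B.grading j) :
    lam φ N b * lam φ N c = ksign (i * j) • (lam φ N c * lam φ N b) := by
  rw [← lam_mul, B.gcomm _ _ hb hc, map_zsmul, lam_mul]

theorem mu_mul_mu {i j : ℤ} {b c : B.carrier} (hb : b ∈ B.grading i) (hc : c ∈ B.grading j) :
    mu φ N b * mu φ N c = ksign (i * j) • (mu φ N c * mu φ N b) := by
  rw [← mu_mul, B.gcomm _ _ hb hc, map_zsmul, mu_mul]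

theorem lam_mul_xi {i j : ℤ} {b c : B.carrier} (hb : b ∈ B.grading i) (hc : c ∈ B.grading j) :
    lam φ N b * xi φ N c = ksign (i * j) • (xi φ N c * lam φ N b) := by
  rw [xi_apply, mul_sub, sub_mul, smul_sub, lam_mul_lam hb hc, lam_mul_mu hb hc]

theorem mu_mul_xi {i j : ℤ} {b c : B.carrier} (hb : b ∈ B.grading i) (hc : c ∈ B.grading j) :
    mu φ N b * xi φ N c = ksign (i * j) • (xi φ N c * mu φ N b) := by
  rw [xi_apply, mul_sub, sub_mul, smul_sub, mu_mul_lam hb hc, mu_mul_mu hb hc]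

theorem xi_mul_xi {i j : ℤ} {b c : B.carrier} (hb : b ∈ B.grading i) (hc : c ∈ B.grading j) :
    xi φ N b * xi φ N c = ksign (i * j) • (xi φ N c * xi φ N b) := by
  rw [xi_apply φ N b, sub_mul, mul_sub, smul_sub, lam_mul_xi hb hc, mu_mul_xi hb hc]

theorem mu_mul_self {i : ℤ} (hi : Odd i) {b : B.carrier} (hb : b ∈ B.grading i) :
    mu φ N b * mu φ N b = 0 := by
  rw [← mu_mul, B.odd_sq b hi hb, map_zero]

theorem xi_mul_self {i : ℤ} (hi : Odd i) {b : B.carrier} (hb : b ∈ B.grading i) :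
    xi φ N b * xi φ N b = 0 := by
  have h1 : lam φ N b * lam φ N b = 0 := by rw [← lam_mul, B.odd_sq b hi hb, map_zero]
  have hs : ksign (i * i) = -1 := by
    rw [ksign_eq_ite, if_neg]; rw [Int.not_even_iff_odd]; exact hi.mul hi
  rw [xi_apply, sub_mul, mul_sub, mul_sub, h1, mu_mul_self hi hb, lam_mul_mu hb hb, hs]
  simp

theorem indD_mul_lam {i : ℤ} {b : B.carrier} (hb : b ∈ B.grading i) :
    indD φ N * lam φ N b = lam φ N (B.d b) + ksign i • (lam φ N b * indD φ N) :=
  ind_hom_ext fun j l x c hx hc => by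
    rw [LinearMap.add_apply, LinearMap.smul_apply, Module.End.mul_apply, Module.End.mul_apply,
      lam_tmk φ N hb hx, lam_tmk φ N (B.d_mem hb) hx, indD_tmk φ N hx, map_add, map_zsmul,
      map_zsmul, indD_tmk φ N (N.smul_mem hx hb), lam_tmk φ N hb (N.d_mem hx),
      lam_tmk φ N hb hx, N.leibniz _ _ hx, map_add, map_zsmul]
    simp only [LinearMap.add_apply, LinearMap.smul_apply, smul_add, smul_smul,
      sub_eq_add_neg, mul_add, add_mul, ksign_add]
    simp only [ksign_eq_ite, Int.even_mul, even_neg]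
    by_cases h1 : Even i <;> by_cases h2 : Even j <;> simp [h1, h2] <;> abel

theorem indD_mul_mu {i : ℤ} {b : B.carrier} (hb : b ∈ B.grading i) :
    indD φ N * mu φ N b = mu φ N (B.d b) + ksign i • (mu φ N b * indD φ N) :=
  ind_hom_ext fun j l x c hx hc => by
    rw [LinearMap.add_apply, LinearMap.smul_apply, Module.End.mul_apply, Module.End.mul_apply,
      mu_tmk φ N hb hx, mu_tmk φ N (B.d_mem hb) hx, indD_tmk φ N hx, map_add, map_zsmul,
      map_zsmul, indD_tmk φ N hx, mu_tmk φ N hb (N.d_mem hx),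
      mu_tmk φ N hb hx, B.leibniz _ _ hb, map_add, map_zsmul]
    simp only [smul_add, smul_smul,
      sub_eq_add_neg, mul_add, add_mul, ksign_add]
    simp only [ksign_eq_ite, Int.even_mul, even_neg]
    by_cases h1 : Even i <;> by_cases h2 : Even j <;> simp [h1, h2] <;> abel

theorem indD_mul_xi {i : ℤ} {b : B.carrier} (hb : b ∈ B.grading i) :
    indD φ N * xi φ N b = xi φ N (B.d b) + ksign i • (xi φ N b * indD φ N) := by
  rw [xi_apply, xi_apply, mul_sub, sub_mul, indD_mul_lam hb, indD_mul_mu hb, smul_sub]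
  abel

theorem xi_indAct (b c : B.carrier) (t : Ind φ N) :
    xi φ N b (indAct φ N c t) = indAct φ N c (xi φ N b t) := by
  have : (xi φ N).compr₂ (indAct φ N c) = (xi φ N).compl₂ (indAct φ N c) :=
    hom_ext_graded B.grading fun i b hb => ind_hom_ext fun k l x e hx he => by
      simp [xi_apply, lam_tmk φ N hb hx, mu_tmk φ N hb hx, mul_assoc]
  exact (LinearMap.congr_fun₂ this b t).symm

theorem lam_mem {i k : ℤ} {b : B.carrier} (hb : b ∈ B.grading i) {t : Ind φ N}
    (ht : t ∈ indGrading φ N k) : lam φ N b t ∈ indGrading φ N (k + i) :=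
  map_mem_of_tmk (indGrading φ N) (lam φ N b) i (fun j l x c hx hc => by
    rw [lam_tmk φ N hb hx, add_right_comm]
    exact zsmul_mem (tmk_mem (N.smul_mem hx hb) hc) _) ht

theorem mu_mem {i k : ℤ} {b : B.carrier} (hb : b ∈ B.grading i) {t : Ind φ N}
    (ht : t ∈ indGrading φ N k) : mu φ N b t ∈ indGrading φ N (k + i) :=
  map_mem_of_tmk (indGrading φ N) (mu φ N b) i (fun j l x c hx hc => by
    rw [mu_tmk φ N hb hx, add_assoc, add_comm l i]
    exact zsmul_mem (tmk_mem hx (B.mul_mem hb hc)) _) ht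

theorem xi_mem {i k : ℤ} {b : B.carrier} (hb : b ∈ B.grading i) {t : Ind φ N}
    (ht : t ∈ indGrading φ N k) : xi φ N b t ∈ indGrading φ N (k + i) :=
  sub_mem (lam_mem hb ht) (mu_mem hb ht)

variable (φ N) in
/-- The canonical map `π : N|_A ⊗_A B → N`. -/
def indPi : Ind φ N →ₗ[R] N.carrier :=
  tlift (act N) fun i j k x a b _ _ _ => by simp [N.smul_mul]

@[simp] theorem indPi_tmk (x : N.carrier) (b : B.carrier) :
    indPi φ N (tmk φ N x b) = N.smul x b := rfl

theorem indPi_xi (b : B.carrier) (t : Ind φ N) : indPi φ N (xi φ N b t) = 0 := by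
  have : (xi φ N).compr₂ (indPi φ N) = 0 :=
    hom_ext_graded B.grading fun i b hb => ind_hom_ext fun k l x e hx he => by
      simp [xi_apply, lam_tmk φ N hb hx, mu_tmk φ N hb hx, N.smul_mul]
  exact LinearMap.congr_fun₂ this b t

end

section Monomials

variable {ι : Type} {deg : ι → ℤ}

/-- A family of ring elements obeying the sign rules of a strongly graded commutative algebra. -/
structure GradedCommuting (deg : ι → ℤ) {S : Type} [Ring S] (g : ι → S) : Prop where
  comm : ∀ i j, g i * g j = ksign (deg i * deg j) • (g j * g i)
  sq : ∀ i, Odd (deg i) → g i * g i = 0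

theorem exists_prod_eq_of_perm {l l' : List ι} (h : l.Perm l') :
    ∃ ε : ℤ, ∀ {S : Type} [Ring S] (g : ι → S), GradedCommuting deg g →
      (l.map g).prod = ε • (l'.map g).prod := by
  induction h with
  | nil => exact ⟨1, fun g _ => by simp⟩
  | @cons a l l' _ ih =>
    obtain ⟨ε, hε⟩ := ih
    exact ⟨ε, fun g hg => by
      rw [List.map_cons, List.prod_cons, hε g hg, mul_smul_comm, List.map_cons, List.prod_cons]⟩
  | swap a b l =>
    exact ⟨ksign (deg b * deg a), fun g hg => by
      simp only [List.map_cons, List.prod_cons, ← mul_assoc, hg.comm b a, smul_mul_assoc]⟩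
  | trans _ _ ih ih' =>
    obtain ⟨ε, hε⟩ := ih
    obtain ⟨ε', hε'⟩ := ih'
    exact ⟨ε * ε', fun g hg => by rw [hε g hg, hε' g hg, smul_smul]⟩

variable [LinearOrder ι]

/-- The increasing word underlying a monomial. -/
def word (m : ι →₀ ℕ) : List ι :=
  (m.support.sort (· ≤ ·)).flatMap fun i => List.replicate (m i) i

theorem coe_word (m : ι →₀ ℕ) : (word m : Multiset ι) = Finsupp.toMultiset m := by
  rw [word, ← Multiset.coe_bind, Finset.sort_eq, Finsupp.toMultiset_apply, Finsupp.sum,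
    Multiset.bind, Multiset.join, Finset.sum]
  congr 1
  refine Multiset.map_congr rfl fun i _ => ?_
  rw [Multiset.coe_replicate, Multiset.nsmul_singleton]

theorem count_word (m : ι →₀ ℕ) (i : ι) : (word m).count i = m i := by
  rw [← Multiset.coe_count, coe_word, Finsupp.count_toMultiset]

theorem gradMonomial_eq {S : Type} [Ring S] (g : ι → S) (m : MonIdx ι deg) :
    gradMonomial deg (fun i k => g i ^ k) m = ((word m.1).map g).prod := by
  rw [gradMonomial, word, List.map_flatMap, List.flatMap, List.prod_flatten, List.map_map]
  congr 1
  refine List.map_congr_left fun i _ => ?_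
  simp

/-- The product of a graded commuting family along a monomial. -/
def mon (deg : ι → ℤ) {S : Type} [Ring S] (g : ι → S) (m : MonIdx ι deg) : S :=
  ((word m.1).map g).prod

/-- The sum of the values of a function along the word of a monomial. -/
def wsum {M : Type} [AddMonoid M] (f : ι → M) (m : MonIdx ι deg) : M :=
  ((word m.1).map f).sum

/-- The trivial monomial. -/
def monZero (deg : ι → ℤ) : MonIdx ι deg := ⟨0, fun _ _ => Nat.zero_le _⟩

@[simp] theorem word_zero : word (0 : ι →₀ ℕ) = [] := by simp [word]

@[simp] theorem mon_zero {S : Type} [Ring S] (g : ι → S) : mon deg g (monZero deg) = 1 := by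
  simp [mon, monZero]

@[simp] theorem wsum_zero {M : Type} [AddMonoid M] (f : ι → M) : wsum f (monZero deg) = 0 := by
  simp [wsum, monZero]

theorem map_mon {S S' : Type} [Ring S] [Ring S'] (f : S →+* S') (g : ι → S)
    (m : MonIdx ι deg) : f (mon deg g m) = mon deg (fun i => f (g i)) m := by
  rw [mon, mon, map_list_prod, List.map_map]; rfl

/-- Multiplying a monomial by a variable gives zero or, up to sign, another monomial. -/
theorem mul_mon (i : ι) (m : MonIdx ι deg) :
    (∀ {S : Type} [Ring S] (g : ι → S), GradedCommuting deg g → g i * mon deg g m = 0) ∨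
    ∃ (ε : ℤ) (m' : MonIdx ι deg),
      (∀ {M : Type} [AddCommMonoid M] (f : ι → M), wsum f m' = f i + wsum f m) ∧
      ∀ {S : Type} [Ring S] (g : ι → S), GradedCommuting deg g →
        g i * mon deg g m = ε • mon deg g m' := by
  by_cases h : Odd (deg i) ∧ m.1 i ≠ 0
  · left
    intro S _ g hg
    have hmem : i ∈ word m.1 := by
      rw [← List.count_pos_iff, count_word]; exact Nat.pos_of_ne_zero h.2
    obtain ⟨ε, hε⟩ := exists_prod_eq_of_perm (deg := deg) (List.perm_cons_erase hmem)
    rw [mon, hε g hg, mul_smul_comm, List.map_cons, List.prod_cons, ← mul_assoc, hg.sq i h.1,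
      zero_mul, smul_zero]
  · right
    let m' : MonIdx ι deg := ⟨Finsupp.single i 1 + m.1, fun j hj => by
      rw [Finsupp.add_apply]
      by_cases hij : i = j
      · subst hij
        have : m.1 i = 0 := by by_contra h'; exact h ⟨hj, h'⟩
        simp [this]
      · simpa [Finsupp.single_apply, hij] using m.2 j hj⟩
    have hp : (i :: word m.1).Perm (word m'.1) := by
      rw [← Multiset.coe_eq_coe, ← Multiset.cons_coe, coe_word, coe_word, map_add,
        Finsupp.toMultiset_single, one_smul, Multiset.singleton_add]
    obtain ⟨ε, hε⟩ := exists_prod_eq_of_perm (deg := deg) hp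
    refine ⟨ε, m', fun f => ?_, fun g hg => ?_⟩
    · rw [wsum, wsum, ← (hp.map f).sum_eq, List.map_cons, List.sum_cons]
    · rw [mon, mon, ← hε g hg, List.map_cons, List.prod_cons]

theorem mon_induction {S : Type} [Ring S] (g : ι → S) (P : S → Prop) (one : P 1)
    (mul : ∀ i s, P s → P (g i * s)) (m : MonIdx ι deg) : P (mon deg g m) := by
  rw [mon]
  induction word m.1 with
  | nil => simpa using one
  | cons i l ih => rw [List.map_cons, List.prod_cons]; exact mul i _ ih

theorem mon_wsum_induction {S M : Type} [Ring S] [AddMonoid M] (g : ι → S) (f : ι → M)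
    (P : S → M → Prop) (one : P 1 0) (mul : ∀ i s a, P s a → P (g i * s) (f i + a))
    (m : MonIdx ι deg) : P (mon deg g m) (wsum f m) := by
  rw [mon, wsum]
  induction word m.1 with
  | nil => simpa using one
  | cons i l ih =>
    rw [List.map_cons, List.prod_cons, List.map_cons, List.sum_cons]
    exact mul i _ _ ih

theorem finite_wsum_eq [Finite ι] (w : ι → ℕ) (hw : ∀ i, 1 ≤ w i) (k : ℕ) :
    {m : MonIdx ι deg | wsum w m = k}.Finite := by
  refine Set.Finite.of_finite_image (f := Subtype.val) ?_ Subtype.val_injective.injOn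
  refine (Set.finite_Icc 0 (Finsupp.equivFunOnFinite.symm fun _ : ι => k)).subset ?_
  rintro _ ⟨m, rfl, rfl⟩
  refine ⟨fun _ => Nat.zero_le _, fun i => ?_⟩
  have h1 : ∀ l : List ι, l.length ≤ (l.map w).sum := fun l => by
    induction l with
    | nil => simp
    | cons a l ih => simp only [List.length_cons, List.map_cons, List.sum_cons]; have := hw a; omega
  rw [← count_word]
  exact List.count_le_length.trans (h1 _)

end Monomials

section

variable {R : Type} [CommRing R] {A B : DGAlgebra R} {φ : DGAlgHom A B} {N : DGModule R B}
  {ι : Type} [LinearOrder ι] {X : ι → B.carrier} {degX : ι → ℤ}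

theorem mul_mon_comm {S : Type} [Ring S] {h : S} {k : ℤ} {g : ι → S}
    (hc : ∀ i, h * g i = ksign (k * degX i) • (g i * h)) (m : MonIdx ι degX) :
    h * mon degX g m = ksign (k * wsum degX m) • (mon degX g m * h) := by
  refine mon_wsum_induction g degX (fun s a => h * s = ksign (k * a) • (s * h)) ?_ ?_ m
  · simp [ksign_zero]
  · intro i s a hs
    rw [← mul_assoc, hc, smul_mul_assoc, mul_assoc, hs, mul_smul_comm, smul_smul, mul_add,
      ksign_add, mul_assoc]

theorem mon_mem (hX : ∀ i, X i ∈ B.grading (degX i)) (m : MonIdx ι degX) :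
    mon degX X m ∈ B.grading (wsum degX m) :=
  mon_wsum_induction X degX (fun s a => s ∈ B.grading a) B.one_mem
    (fun i _ _ hs => B.mul_mem (hX i) hs) m

omit [LinearOrder ι] in
theorem gradedCommuting_mu (hX : ∀ i, X i ∈ B.grading (degX i)) :
    GradedCommuting degX fun i => mu φ N (X i) :=
  ⟨fun i j => mu_mul_mu (hX i) (hX j), fun i hi => mu_mul_self hi (hX i)⟩

omit [LinearOrder ι] in
theorem gradedCommuting_xi (hX : ∀ i, X i ∈ B.grading (degX i)) :
    GradedCommuting degX fun i => xi φ N (X i) :=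
  ⟨fun i j => xi_mul_xi (hX i) (hX j), fun i hi => xi_mul_self hi (hX i)⟩

variable (φ N X degX)

/-- The map `n ↦ n ⊗ 1`. -/
def tone : N.carrier →ₗ[R] Ind φ N := (tmk φ N).flip 1

theorem tone_apply (x : N.carrier) : tone φ N x = tmk φ N x 1 := rfl

/-- The monomials in the operators `1 ⊗ X_i`. -/
def mum (m : MonIdx ι degX) : Module.End R (Ind φ N) := mon degX (fun i => mu φ N (X i)) m

/-- The monomials in the operators `X_i ⊗ 1 - 1 ⊗ X_i`. -/
def xim (m : MonIdx ι degX) : Module.End R (Ind φ N) := mon degX (fun i => xi φ N (X i)) m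

variable {φ N X degX}

theorem mu_tone {i : ℤ} {b : B.carrier} (hb : b ∈ B.grading i) (x : N.carrier) :
    mu φ N b (tone φ N x) = tmk φ N (twist N.grading i x) b := by
  have : mu φ N b ∘ₗ tone φ N = (tmk φ N).flip b ∘ₗ twist N.grading i :=
    hom_ext_graded N.grading fun j x hx => by
      simp [tone_apply, mu_tmk φ N hb hx, twist_apply _ _ hx]
  exact LinearMap.congr_fun this x

theorem lam_tone (b : B.carrier) (x : N.carrier) :
    lam φ N b (tone φ N x) = tone φ N (leftAct N b x) := rfl

theorem mum_tone (hX : ∀ i, X i ∈ B.grading (degX i)) (m : MonIdx ι degX) (x : N.carrier) :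
    mum φ N X degX m (tone φ N x) =
      tmk φ N (twist N.grading (wsum degX m) x) (mon degX X m) := by
  have : mum φ N X degX m = mu φ N (mon degX X m) :=
    (map_mon (muAlg φ N).toRingHom X m).symm
  rw [this, mu_tone (mon_mem hX m)]

section Coordinates

variable (hX : ∀ i, X i ∈ B.grading (degX i))
  (hB : Function.Bijective (fun c : MonIdx ι degX →₀ A.carrier =>
    c.sum fun m a => gradMonomial degX (fun i k => X i ^ k) m * φ.toFun a))

variable (A degX) in
/-- The sign change of coefficients interchanging left and right coefficients. -/
def coeffTwist : (MonIdx ι degX →₀ A.carrier) →ₗ[R] (MonIdx ι degX →₀ A.carrier) :=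
  Finsupp.lsum R fun m => Finsupp.lsingle m ∘ₗ twist A.grading (wsum degX m)

theorem coeffTwist_coeffTwist (c : MonIdx ι degX →₀ A.carrier) :
    coeffTwist A degX (coeffTwist A degX c) = c := by
  have : coeffTwist A degX ∘ₗ coeffTwist A degX = LinearMap.id := by
    ext m a : 2
    simp [coeffTwist, twist_twist]
  exact LinearMap.congr_fun this c

variable (φ X degX) in
/-- The linear combinations of monomials with coefficients on the left. -/
def leftComb : (MonIdx ι degX →₀ A.carrier) →ₗ[R] B.carrier :=
  Finsupp.lsum R fun m => LinearMap.mulRight R (mon degX X m) ∘ₗ algLin φ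

@[simp] theorem leftComb_single (m : MonIdx ι degX) (a : A.carrier) :
    leftComb φ X degX (Finsupp.single m a) = φ.toFun a * mon degX X m := by
  rw [leftComb, Finsupp.lsum_single]; rfl

include hX in
theorem leftComb_eq (c : MonIdx ι degX →₀ A.carrier) :
    leftComb φ X degX c = (coeffTwist A degX c).sum fun m a =>
      gradMonomial degX (fun i k => X i ^ k) m * φ.toFun a := by
  have h : leftComb φ X degX = (Finsupp.lsum R fun m =>
      LinearMap.mulLeft R (mon degX X m) ∘ₗ algLin φ) ∘ₗ coeffTwist A degX := by
    ext m a : 2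
    simp only [LinearMap.comp_apply, Finsupp.lsingle_apply, leftComb_single]
    simp only [coeffTwist, Finsupp.lsum_apply, map_zero, Finsupp.sum_single_index,
      LinearMap.comp_apply, Finsupp.lsingle_apply, LinearMap.mulLeft_apply]
    have h2 : LinearMap.mulRight R (mon degX X m) ∘ₗ algLin φ =
        LinearMap.mulLeft R (mon degX X m) ∘ₗ algLin φ ∘ₗ twist A.grading (wsum degX m) :=
      hom_ext_graded A.grading fun j a ha => by
        simp only [LinearMap.comp_apply, LinearMap.mulRight_apply, algLin_apply,
          LinearMap.mulLeft_apply, twist_apply _ _ ha, map_zsmul]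
        rw [B.gcomm _ _ (φ.map_mem ha) (mon_mem hX m), mul_comm j]
    exact LinearMap.congr_fun h2 a
  rw [h]
  simp only [gradMonomial_eq]
  rfl

include hX hB in
theorem leftComb_bijective : Function.Bijective (leftComb φ X degX) := by
  have : (leftComb φ X degX : (MonIdx ι degX →₀ A.carrier) → B.carrier) =
      (fun c : MonIdx ι degX →₀ A.carrier =>
        c.sum fun m a => gradMonomial degX (fun i k => X i ^ k) m * φ.toFun a) ∘
      coeffTwist A degX := funext (leftComb_eq hX)
  rw [this]
  exact hB.comp (Function.Involutive.bijective coeffTwist_coeffTwist)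

/-- The coordinates with respect to the basis of monomials, with coefficients on the left. -/
def coord : B.carrier ≃ₗ[R] (MonIdx ι degX →₀ A.carrier) :=
  (LinearEquiv.ofBijective _ (leftComb_bijective hX hB)).symm

theorem coord_leftComb (c : MonIdx ι degX →₀ A.carrier) :
    coord hX hB (leftComb φ X degX c) = c :=
  (LinearEquiv.ofBijective _ (leftComb_bijective hX hB)).symm_apply_apply c

theorem leftComb_coord (b : B.carrier) : leftComb φ X degX (coord hX hB b) = b :=
  (LinearEquiv.ofBijective _ (leftComb_bijective hX hB)).apply_symm_apply b

theorem coord_map_mul (a : A.carrier) (b : B.carrier) :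
    coord hX hB (φ.toFun a * b) =
      Finsupp.mapRange.linearMap (LinearMap.mulLeft R a) (coord hX hB b) := by
  have h : ∀ c, leftComb φ X degX (Finsupp.mapRange.linearMap (LinearMap.mulLeft R a) c) =
      φ.toFun a * leftComb φ X degX c := fun c => by
    have : leftComb φ X degX ∘ₗ Finsupp.mapRange.linearMap (LinearMap.mulLeft R a) =
        LinearMap.mulLeft R (φ.toFun a) ∘ₗ leftComb φ X degX := by
      ext m a' : 2
      simp [φ.map_mul, mul_assoc, -Finsupp.single_mul]
    exact LinearMap.congr_fun this c
  rw [← leftComb_coord hX hB b, ← h, coord_leftComb, leftComb_coord]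

variable (φ N X degX) in
/-- The bilinear map underlying the coordinates of `N|_A ⊗_A B`. -/
def coordAux : N.carrier →ₗ[R] (MonIdx ι degX →₀ A.carrier) →ₗ[R]
    (MonIdx ι degX →₀ N.carrier) where
  toFun x := Finsupp.lsum R fun m =>
    Finsupp.lsingle m ∘ₗ twist N.grading (wsum degX m) ∘ₗ act N x ∘ₗ algLin φ
  map_add' x y := by ext m a : 2; simp [Finsupp.lsum_single]
  map_smul' r x := by
    ext m a : 2
    simp only [LinearMap.comp_apply, LinearMap.smul_apply, RingHom.id_apply,
      Finsupp.lsingle_apply, Finsupp.lsum_single, map_smul, Finsupp.smul_single]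

@[simp] theorem coordAux_single (x : N.carrier) (m : MonIdx ι degX) (a : A.carrier) :
    coordAux φ N degX x (Finsupp.single m a) =
      Finsupp.single m (twist N.grading (wsum degX m) (N.smul x (φ.toFun a))) := by
  exact Finsupp.lsum_single R _ _ _

theorem coordAux_balanced (x : N.carrier) (a : A.carrier) (c : MonIdx ι degX →₀ A.carrier) :
    coordAux φ N degX (N.smul x (φ.toFun a)) c =
      coordAux φ N degX x (Finsupp.mapRange.linearMap (LinearMap.mulLeft R a) c) := by
  have : coordAux φ N degX (N.smul x (φ.toFun a)) =
      coordAux φ N degX x ∘ₗ Finsupp.mapRange.linearMap (LinearMap.mulLeft R a) := by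
    ext m a' : 2
    simp [φ.map_mul, N.smul_mul, -Finsupp.single_mul]
  rw [this]; rfl

variable (N) in
/-- The coordinates of `N|_A ⊗_A B` with respect to the monomials in the `1 ⊗ X_i`. -/
def muCoord : Ind φ N →ₗ[R] (MonIdx ι degX →₀ N.carrier) :=
  tlift ((coordAux φ N degX).compl₂ (coord hX hB).toLinearMap) fun i j k x a b _ _ _ => by
    simp [coord_map_mul, coordAux_balanced]

variable (φ N X degX) in
/-- The linear combinations of the monomials in the `1 ⊗ X_i`. -/
def muComb : (MonIdx ι degX →₀ N.carrier) →ₗ[R] Ind φ N :=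
  Finsupp.lsum R fun m => mum φ N X degX m ∘ₗ tone φ N

variable (φ N X degX) in
/-- The linear combinations of the monomials in the `X_i ⊗ 1 - 1 ⊗ X_i`. -/
def xiComb : (MonIdx ι degX →₀ N.carrier) →ₗ[R] Ind φ N :=
  Finsupp.lsum R fun m => xim φ N X degX m ∘ₗ tone φ N

@[simp] theorem muComb_single (m : MonIdx ι degX) (x : N.carrier) :
    muComb φ N X degX (Finsupp.single m x) = mum φ N X degX m (tone φ N x) := by
  simp [muComb]

@[simp] theorem xiComb_single (m : MonIdx ι degX) (x : N.carrier) :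
    xiComb φ N X degX (Finsupp.single m x) = xim φ N X degX m (tone φ N x) := by
  simp [xiComb]

theorem muComb_muCoord (t : Ind φ N) : muComb φ N X degX (muCoord N hX hB t) = t := by
  have : muComb φ N X degX ∘ₗ muCoord N hX hB = LinearMap.id :=
    ind_hom_ext fun i j x b hx hb => by
      have h : muComb φ N X degX ∘ₗ coordAux φ N degX x = tmk φ N x ∘ₗ leftComb φ X degX := by
        ext m a : 2
        simp [mum_tone hX, twist_twist, tmk_balanced]
      have h2 := LinearMap.congr_fun h (coord hX hB b)
      simp only [LinearMap.comp_apply, leftComb_coord] at h2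
      exact h2
  exact LinearMap.congr_fun this t

theorem muCoord_mum (m : MonIdx ι degX) (x : N.carrier) :
    muCoord N hX hB (mum φ N X degX m (tone φ N x)) = Finsupp.single m x := by
  have h : mon degX X m = leftComb φ X degX (Finsupp.single m 1) := by simp [φ.map_one]
  rw [mum_tone hX, muCoord, tlift_tmk]
  simp only [LinearMap.compl₂_apply, LinearEquiv.coe_coe]
  rw [h, coord_leftComb, coordAux_single, φ.map_one, N.smul_one, twist_twist]

include hX hB in
theorem ind_hom_ext_mum {P : Type} [AddCommGroup P] [Module R P] {f g : Ind φ N →ₗ[R] P}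
    (h : ∀ m x, f (mum φ N X degX m (tone φ N x)) = g (mum φ N X degX m (tone φ N x))) :
    f = g := by
  have h2 : f ∘ₗ muComb φ N X degX = g ∘ₗ muComb φ N X degX := by
    ext m x : 2
    simpa using h m x
  ext t
  rw [← muComb_muCoord hX hB t]
  exact LinearMap.congr_fun h2 _

variable (N) in
/-- The involution of `N|_A ⊗_A B` fixing the `n ⊗ 1` and interchanging the operators
`1 ⊗ X_i` and `X_i ⊗ 1 - 1 ⊗ X_i`. -/
def swapXi : Ind φ N →ₗ[R] Ind φ N := xiComb φ N X degX ∘ₗ muCoord N hX hB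

theorem swapXi_mum (m : MonIdx ι degX) (x : N.carrier) :
    swapXi N hX hB (mum φ N X degX m (tone φ N x)) = xim φ N X degX m (tone φ N x) := by
  simp [swapXi, muCoord_mum]

theorem swapXi_mul_mu (i : ι) :
    swapXi N hX hB * mu φ N (X i) = xi φ N (X i) * swapXi N hX hB := by
  refine ind_hom_ext_mum hX hB fun m x => ?_
  rw [Module.End.mul_apply, Module.End.mul_apply, swapXi_mum,
    ← Module.End.mul_apply (mu φ N (X i)), ← Module.End.mul_apply (xi φ N (X i))]
  rcases mul_mon (deg := degX) i m with h | ⟨ε, m', -, h⟩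
  · rw [xim, mum, h _ (gradedCommuting_mu hX), h _ (gradedCommuting_xi hX)]
    simp
  · rw [xim, mum, h _ (gradedCommuting_mu hX), h _ (gradedCommuting_xi hX), LinearMap.smul_apply,
      map_zsmul, LinearMap.smul_apply, ← mum, ← xim, swapXi_mum]

theorem swapXi_mul_lam {k : ℤ} {b : B.carrier} (hb : b ∈ B.grading k) :
    swapXi N hX hB * lam φ N b = lam φ N b * swapXi N hX hB := by
  refine ind_hom_ext_mum hX hB fun m x => ?_
  rw [Module.End.mul_apply, Module.End.mul_apply, swapXi_mum,
    ← Module.End.mul_apply (lam φ N b), ← Module.End.mul_apply (lam φ N b), mum, xim,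
    mul_mon_comm fun i => lam_mul_mu hb (hX i),
    mul_mon_comm fun i => lam_mul_xi hb (hX i), LinearMap.smul_apply, LinearMap.smul_apply,
    map_zsmul, Module.End.mul_apply, Module.End.mul_apply, lam_tone, ← mum, ← xim, swapXi_mum]

theorem swapXi_swapXi (t : Ind φ N) : swapXi N hX hB (swapXi N hX hB t) = t := by
  set Θ := swapXi N hX hB with hΘ
  have h1 : ∀ i, Θ * xi φ N (X i) = mu φ N (X i) * Θ := fun i => by
    rw [xi_apply, mul_sub, swapXi_mul_lam hX hB (hX i), swapXi_mul_mu, ← sub_mul, xi_apply,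
      sub_sub_cancel]
  have h2 : ∀ i, (Θ * Θ) * mu φ N (X i) = ksign (0 * degX i) • (mu φ N (X i) * (Θ * Θ)) :=
    fun i => by
      rw [mul_assoc, swapXi_mul_mu, ← mul_assoc, h1, mul_assoc, zero_mul, ksign_zero, one_smul]
  have h0 : ∀ x, Θ (tone φ N x) = tone φ N x := fun x => by
    have := swapXi_mum (N := N) hX hB (monZero degX) x
    simpa [mum, xim] using this
  have : Θ * Θ = 1 := ind_hom_ext_mum hX hB fun m x => by
    rw [← Module.End.mul_apply, mum, mul_mon_comm h2, zero_mul, ksign_zero, one_smul,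
      Module.End.mul_apply, Module.End.mul_apply, h0, h0]
    rfl
  exact LinearMap.congr_fun this t

variable (N) in
/-- The coordinates of `N|_A ⊗_A B` with respect to the monomials in the
`X_i ⊗ 1 - 1 ⊗ X_i`. -/
def xiCoord : Ind φ N ≃ₗ[R] (MonIdx ι degX →₀ N.carrier) :=
  LinearEquiv.ofLinearMap (muCoord N hX hB ∘ₗ swapXi N hX hB) (xiComb φ N X degX)
    (by
      ext m x : 2
      simp only [LinearMap.comp_apply, Finsupp.lsingle_apply, xiComb_single]
      rw [← swapXi_mum hX hB, swapXi_swapXi, muCoord_mum]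
      rfl)
    (by
      ext t
      exact swapXi_swapXi hX hB t)

theorem xiCoord_xim (m : MonIdx ι degX) (x : N.carrier) :
    xiCoord N hX hB (xim φ N X degX m (tone φ N x)) = Finsupp.single m x := by
  rw [← xiComb_single]
  exact (xiCoord N hX hB).apply_symm_apply _

theorem xiComb_xiCoord (t : Ind φ N) : xiComb φ N X degX (xiCoord N hX hB t) = t :=
  (xiCoord N hX hB).symm_apply_apply t

end Coordinates

end

section Filtration

variable {R : Type} [CommRing R] {A B : DGAlgebra R} {φ : DGAlgHom A B} {N : DGModule R B}
  {ι : Type} [LinearOrder ι] {X : ι → B.carrier} {degX : ι → ℤ}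

variable (φ N X degX) in
/-- The filtration of `N|_A ⊗_A B` by the weight of monomials in the `X_i ⊗ 1 - 1 ⊗ X_i`. -/
def filt (w : ι → ℕ) (k : ℕ) : Submodule R (Ind φ N) :=
  Submodule.span R {t | ∃ (m : MonIdx ι degX) (x : N.carrier), k ≤ wsum w m ∧
    t = xim φ N X degX m (tone φ N x)}

variable {w : ι → ℕ}

theorem xim_tone_mem_filt {k : ℕ} {m : MonIdx ι degX} (hm : k ≤ wsum w m) (x : N.carrier) :
    xim φ N X degX m (tone φ N x) ∈ filt φ N X degX w k :=
  Submodule.subset_span ⟨m, x, hm, rfl⟩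

theorem filt_le {k : ℕ} {S : Submodule R (Ind φ N)}
    (h : ∀ (m : MonIdx ι degX) (x : N.carrier), k ≤ wsum w m →
      xim φ N X degX m (tone φ N x) ∈ S) : filt φ N X degX w k ≤ S :=
  Submodule.span_le.2 fun _ ⟨m, x, hm, ht⟩ => ht ▸ h m x hm

theorem filt_anti {k l : ℕ} (h : k ≤ l) : filt φ N X degX w l ≤ filt φ N X degX w k :=
  filt_le fun _ x hm => xim_tone_mem_filt (h.trans hm) x

theorem lam_filt (hX : ∀ i, X i ∈ B.grading (degX i)) (b : B.carrier) {k : ℕ} {t : Ind φ N}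
    (ht : t ∈ filt φ N X degX w k) : lam φ N b t ∈ filt φ N X degX w k := by
  induction b using DirectSum.Decomposition.inductionOn B.grading with
  | zero => simp
  | add b c hb hc => rw [map_add, LinearMap.add_apply]; exact add_mem hb hc
  | homogeneous b =>
    refine filt_le (S := (filt φ N X degX w k).comap (lam φ N b)) (fun m x hm => ?_) ht
    rw [Submodule.mem_comap, ← Module.End.mul_apply, xim,
      mul_mon_comm fun i => lam_mul_xi b.2 (hX i), LinearMap.smul_apply, Module.End.mul_apply,
      lam_tone]
    exact zsmul_mem (xim_tone_mem_filt hm _) _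

theorem xi_var_filt (hX : ∀ i, X i ∈ B.grading (degX i)) (i : ι) {k : ℕ} {t : Ind φ N}
    (ht : t ∈ filt φ N X degX w k) : xi φ N (X i) t ∈ filt φ N X degX w (k + w i) := by
  refine filt_le (S := (filt φ N X degX w (k + w i)).comap (xi φ N (X i))) (fun m x hm => ?_) ht
  rw [Submodule.mem_comap, ← Module.End.mul_apply]
  rcases mul_mon (deg := degX) i m with h | ⟨ε, m', hw, h⟩
  · rw [xim, h _ (gradedCommuting_xi hX)]
    exact zero_mem _
  · rw [xim, h _ (gradedCommuting_xi hX), LinearMap.smul_apply]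
    refine zsmul_mem (xim_tone_mem_filt ?_ _) _
    rw [hw w]; omega

variable (φ N w) in
/-- The elements `b` for which `b ⊗ 1 - 1 ⊗ b` raises the filtration by `s`. -/
def raising (hX : ∀ i, X i ∈ B.grading (degX i)) (s : ℕ) : Subalgebra R B.carrier where
  carrier := {b | ∀ k, ∀ t ∈ filt φ N X degX w k, xi φ N b t ∈ filt φ N X degX w (k + s)}
  mul_mem' {b c} hb hc k t ht := by
    rw [xi_mul]
    refine add_mem (lam_filt hX _ (hc k t ht)) (hb k _ ?_)
    rw [show mu φ N c = lam φ N c - xi φ N c by rw [xi_apply, sub_sub_cancel]]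
    exact sub_mem (lam_filt hX _ ht) (filt_anti (Nat.le_add_right k s) (hc k t ht))
  add_mem' {b c} hb hc k t ht := by
    rw [map_add]; exact add_mem (hb k t ht) (hc k t ht)
  algebraMap_mem' r k t _ := by
    rw [Algebra.algebraMap_eq_smul_one, map_smul, xi_one, smul_zero]; exact zero_mem _

theorem map_mem_raising (hX : ∀ i, X i ∈ B.grading (degX i)) (s : ℕ) (a : A.carrier) :
    φ.toFun a ∈ raising φ N w hX s := fun k t _ => by
  rw [xi_map]; exact zero_mem _

theorem var_mem_raising (hX : ∀ i, X i ∈ B.grading (degX i)) {s : ℕ} {i : ι} (hs : s ≤ w i) :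
    X i ∈ raising φ N w hX s := fun k t ht =>
  filt_anti (by omega) (xi_var_filt hX i ht)

variable (hpoly : PolyExt φ ι X degX)

include hpoly in
theorem xi_filt (hw : ∀ i, 1 ≤ w i) (b : B.carrier) {k : ℕ} {t : Ind φ N}
    (ht : t ∈ filt φ N X degX w k) : xi φ N b t ∈ filt φ N X degX w (k + 1) := by
  suffices h : b ∈ raising φ N w hpoly.homog 1 from h k t ht
  obtain ⟨c, rfl⟩ := hpoly.basis.2 b
  refine sum_mem fun m _ => mul_mem ?_ (map_mem_raising _ _ _)
  refine list_prod_mem fun y hy => ?_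
  obtain ⟨j, -, rfl⟩ := List.mem_map.1 hy
  exact pow_mem (var_mem_raising _ (hw j)) _

include hpoly in
theorem xi_d_var_filt (hw : ∀ i j, i < j → w j + 1 ≤ w i) (i : ι) {k : ℕ} {t : Ind φ N}
    (ht : t ∈ filt φ N X degX w k) :
    xi φ N (B.d (X i)) t ∈ filt φ N X degX w (k + (w i + 1)) := by
  suffices h : B.d (X i) ∈ raising φ N w hpoly.homog (w i + 1) from h k t ht
  obtain ⟨c, hc, hd⟩ := hpoly.d_prev i
  rw [hd]
  refine sum_mem fun m hm => mul_mem ?_ (map_mem_raising _ _ _)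
  refine list_prod_mem fun y hy => ?_
  obtain ⟨j, hj, rfl⟩ := List.mem_map.1 hy
  refine pow_mem (var_mem_raising _ (hw j i ?_)) _
  by_contra hij
  rw [Finset.mem_sort, Finsupp.mem_support_iff] at hj
  exact hj (hc m hm j (not_lt.1 hij))

theorem xim_filt (hX : ∀ i, X i ∈ B.grading (degX i)) (m : MonIdx ι degX) {k : ℕ} {t : Ind φ N}
    (ht : t ∈ filt φ N X degX w k) : xim φ N X degX m t ∈ filt φ N X degX w (k + wsum w m) := by
  refine mon_wsum_induction (fun i => xi φ N (X i)) w
    (fun s a => s t ∈ filt φ N X degX w (k + a)) ht (fun i s a hs => ?_) m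
  rw [Module.End.mul_apply, add_comm (w i), ← add_assoc]
  exact xi_var_filt hX i hs

theorem xim_mem (hX : ∀ i, X i ∈ B.grading (degX i)) (m : MonIdx ι degX) {k : ℤ} {t : Ind φ N}
    (ht : t ∈ indGrading φ N k) :
    xim φ N X degX m t ∈ indGrading φ N (k + wsum degX m) := by
  refine mon_wsum_induction (fun i => xi φ N (X i)) degX
    (fun s a => s t ∈ indGrading φ N (k + a)) (by simpa using ht) (fun i s a hs => ?_) m
  rw [Module.End.mul_apply, add_comm (degX i), ← add_assoc]
  exact xi_mem (hX i) hs

theorem tone_mem {k : ℤ} {x : N.carrier} (hx : x ∈ N.grading k) :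
    tone φ N x ∈ indGrading φ N k := by
  have := tmk_mem (φ := φ) hx B.one_mem
  rwa [add_zero] at this

theorem xim_indAct (b : B.carrier) (m : MonIdx ι degX) (t : Ind φ N) :
    xim φ N X degX m (indAct φ N b t) = indAct φ N b (xim φ N X degX m t) := by
  refine mon_induction (fun i => xi φ N (X i)) (fun s => s (indAct φ N b t) = indAct φ N b (s t))
    rfl (fun i s hs => ?_) m
  rw [Module.End.mul_apply, hs, xi_indAct, Module.End.mul_apply]

include hpoly in
theorem filt_zero : filt φ N X degX w 0 = ⊤ := by
  rw [eq_top_iff]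
  intro t _
  rw [← xiComb_xiCoord hpoly.homog hpoly.basis t, xiComb, Finsupp.lsum_apply]
  exact sum_mem fun m _ => xim_tone_mem_filt (Nat.zero_le _) _

include hpoly in
theorem indD_xim (hw : ∀ i j, i < j → w j + 1 ≤ w i) (m : MonIdx ι degX) (t : Ind φ N) :
    indD φ N (xim φ N X degX m t) - ksign (wsum degX m) • xim φ N X degX m (indD φ N t) ∈
      filt φ N X degX w (wsum w m + 1) := by
  have key : ∀ l : List ι, (l.map fun i => xi φ N (X i)).prod t ∈ filt φ N X degX w (l.map w).sum ∧
      indD φ N ((l.map fun i => xi φ N (X i)).prod t) -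
        ksign (l.map degX).sum • (l.map fun i => xi φ N (X i)).prod (indD φ N t) ∈
      filt φ N X degX w ((l.map w).sum + 1) := fun l => by
    induction l with
    | nil => simp [ksign_zero, filt_zero hpoly]
    | cons i l ih =>
      simp only [List.map_cons, List.prod_cons, List.sum_cons, Module.End.mul_apply]
      set s := (l.map fun i => xi φ N (X i)).prod
      refine ⟨?_, ?_⟩
      · rw [add_comm]; exact xi_var_filt hpoly.homog i ih.1
      have h1 := xi_d_var_filt hpoly hw i ih.1
      have h2 := zsmul_mem (xi_var_filt hpoly.homog i ih.2) (ksign (degX i))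
      have h3 := LinearMap.congr_fun (indD_mul_xi (φ := φ) (N := N) (hpoly.homog i)) (s t)
      simp only [Module.End.mul_apply, LinearMap.add_apply, LinearMap.smul_apply] at h3
      rw [h3, ksign_add, mul_smul, add_sub_assoc, ← smul_sub, ← map_zsmul, ← map_sub]
      refine add_mem ?_ ?_
      · convert h1 using 2; ring
      · convert h2 using 2; ring
  exact (key _).2

theorem algD_one : B.d 1 = 0 := by
  have := B.leibniz 1 1 B.one_mem
  rw [mul_one, mul_one, one_mul, ksign_zero, one_smul] at this
  simpa using this

theorem indD_tone (x : N.carrier) : indD φ N (tone φ N x) = tone φ N (N.d x) := by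
  have : indD φ N ∘ₗ tone φ N = tone φ N ∘ₗ modD N :=
    hom_ext_graded N.grading fun i x hx => by
      simp [tone_apply, indD_tmk φ N hx, algD_one]
  exact LinearMap.congr_fun this x

include hpoly in
theorem indAct_tone (hw : ∀ i, 1 ≤ w i) (b : B.carrier) (x : N.carrier) :
    indAct φ N b (tone φ N x) - tone φ N (N.smul x b) ∈ filt φ N X degX w 1 := by
  induction x using DirectSum.Decomposition.inductionOn N.grading with
  | zero => rw [← act_apply, map_zero, map_zero]; simp
  | add x y hx hy =>
    rw [N.add_smul, map_add, map_add, map_add, add_sub_add_comm]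
    exact add_mem hx hy
  | @homogeneous j x =>
  induction b using DirectSum.Decomposition.inductionOn B.grading with
  | zero =>
    rw [← act_apply, map_zero, map_zero, tone_apply, indAct_tmk, mul_zero, map_zero, sub_zero]
    exact zero_mem _
  | add b c hb hc =>
    rw [tone_apply, indAct_tmk] at *
    rw [mul_add, map_add, N.smul_add, map_add, add_sub_add_comm]
    exact add_mem hb hc
  | @homogeneous i b =>
    have h := xi_filt (w := w) (N := N) hpoly hw b (k := 0) (t := tone φ N x)
      (by rw [filt_zero hpoly]; trivial)
    rw [xi_apply, LinearMap.sub_apply, tone_apply, lam_tmk φ N b.2 x.2, mu_tmk φ N b.2 x.2,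
      ← smul_sub, mul_one] at h
    have h' := neg_mem (zsmul_mem h (ksign (i * j)))
    rw [ksign_smul_smul, neg_sub] at h'
    simpa [tone_apply] using h'

section Coord

theorem xiCoord_of_mem_filt {k : ℕ} {t : Ind φ N} (ht : t ∈ filt φ N X degX w k)
    {m : MonIdx ι degX} (hm : wsum w m < k) :
    xiCoord N hpoly.homog hpoly.basis t m = 0 := by
  refine filt_le (S := LinearMap.ker ((Finsupp.lapply m) ∘ₗ
    (xiCoord N hpoly.homog hpoly.basis).toLinearMap)) (fun m' x hm' => ?_) ht
  simp only [LinearMap.mem_ker, LinearMap.comp_apply, LinearEquiv.coe_coe, xiCoord_xim,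
    Finsupp.lapply_apply]
  exact Finsupp.single_eq_of_ne (fun h => by subst h; omega)

theorem mem_filt_iff {k : ℕ} {t : Ind φ N} : t ∈ filt φ N X degX w k ↔
    ∀ m, wsum w m < k → xiCoord N hpoly.homog hpoly.basis t m = 0 := by
  refine ⟨fun ht m hm => xiCoord_of_mem_filt hpoly ht hm, fun h => ?_⟩
  rw [← xiComb_xiCoord hpoly.homog hpoly.basis t, xiComb, Finsupp.lsum_apply]
  refine sum_mem fun m hm => xim_tone_mem_filt ?_ _
  by_contra h'
  exact Finsupp.mem_support_iff.1 hm (h m (not_le.1 h'))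

theorem xiCoord_indD (hw : ∀ i j, i < j → w j + 1 ≤ w i) {m : MonIdx ι degX} {t : Ind φ N}
    (ht : t ∈ filt φ N X degX w (wsum w m)) :
    xiCoord N hpoly.homog hpoly.basis (indD φ N t) m =
      ksign (wsum degX m) • N.d (xiCoord N hpoly.homog hpoly.basis t m) := by
  set q := (xiCoord N hpoly.homog hpoly.basis).toLinearMap with hq
  refine filt_le (S := LinearMap.eqLocus (Finsupp.lapply m ∘ₗ q ∘ₗ indD φ N)
    (ksign (wsum degX m) • (modD N ∘ₗ Finsupp.lapply m ∘ₗ q))) (fun m' x hm' => ?_) ht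
  have h := indD_xim hpoly hw m' (tone φ N x)
  have h0 := xiCoord_of_mem_filt hpoly h (m := m) (by omega)
  rw [indD_tone, map_sub, map_zsmul, xiCoord_xim, Finsupp.sub_apply, sub_eq_zero] at h0
  simp only [LinearMap.mem_eqLocus, LinearMap.comp_apply, LinearMap.smul_apply, hq,
    LinearEquiv.coe_coe, Finsupp.lapply_apply, h0, xiCoord_xim, modD_apply]
  by_cases hmm : m' = m
  · subst hmm; simp
  · rw [Finsupp.smul_apply, Finsupp.single_eq_of_ne (Ne.symm hmm),
      Finsupp.single_eq_of_ne (Ne.symm hmm), ← modD_apply, map_zero, smul_zero, smul_zero]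

theorem xiCoord_indAct (hw : ∀ i, 1 ≤ w i) (b : B.carrier) {m : MonIdx ι degX} {t : Ind φ N}
    (ht : t ∈ filt φ N X degX w (wsum w m)) :
    xiCoord N hpoly.homog hpoly.basis (indAct φ N b t) m =
      N.smul (xiCoord N hpoly.homog hpoly.basis t m) b := by
  set q := (xiCoord N hpoly.homog hpoly.basis).toLinearMap with hq
  refine filt_le (S := LinearMap.eqLocus (Finsupp.lapply m ∘ₗ q ∘ₗ indAct φ N b)
    ((act N).flip b ∘ₗ Finsupp.lapply m ∘ₗ q)) (fun m' x hm' => ?_) ht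
  have h := xim_filt hpoly.homog m' (indAct_tone hpoly hw b x)
  have h0 := xiCoord_of_mem_filt hpoly h (m := m) (by omega)
  rw [map_sub, xim_indAct, map_sub, xiCoord_xim, Finsupp.sub_apply, sub_eq_zero] at h0
  simp only [LinearMap.mem_eqLocus, LinearMap.comp_apply, hq,
    LinearEquiv.coe_coe, Finsupp.lapply_apply, h0, xiCoord_xim, LinearMap.flip_apply]
  by_cases hmm : m' = m
  · subst hmm; simp
  · rw [Finsupp.single_eq_of_ne (Ne.symm hmm), Finsupp.single_eq_of_ne (Ne.symm hmm), map_zero,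
      LinearMap.zero_apply]

include hpoly in
theorem span_xim_tone : Submodule.span R {t : Ind φ N | ∃ (m : MonIdx ι degX) (i : ℤ)
    (x : N.carrier), x ∈ N.grading i ∧ t = xim φ N X degX m (tone φ N x)} = ⊤ := by
  rw [eq_top_iff, ← filt_zero (w := fun _ => 0) hpoly]
  refine filt_le fun m x _ => ?_
  induction x using DirectSum.Decomposition.inductionOn N.grading with
  | zero => simp
  | add x y hx hy => rw [map_add, map_add]; exact add_mem hx hy
  | @homogeneous i x => exact Submodule.subset_span ⟨m, i, x, x.2, rfl⟩

instance : DirectSum.Decomposition (indGrading φ N) :=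
  decompositionOf _ (indGrading_disjoint φ N) (iSup_indGrading φ N)

theorem xiCoord_mem (m : MonIdx ι degX) {k : ℤ} {t : Ind φ N} (ht : t ∈ indGrading φ N k) :
    xiCoord N hpoly.homog hpoly.basis t m ∈ N.grading (k + -wsum degX m) := by
  refine map_mem_of_span (indGrading φ N) N.grading
    (Finsupp.lapply m ∘ₗ (xiCoord N hpoly.homog hpoly.basis).toLinearMap) (-wsum degX m) ?_ ht
  rw [eq_top_iff, ← span_xim_tone hpoly, Submodule.span_le]
  rintro _ ⟨m', i, x, hx, rfl⟩
  refine Submodule.subset_span ⟨_, xim_mem hpoly.homog m' (tone_mem hx), ?_⟩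
  simp only [LinearMap.comp_apply, LinearEquiv.coe_coe, xiCoord_xim, Finsupp.lapply_apply]
  by_cases hmm : m' = m
  · subst hmm; simpa using hx
  · rw [Finsupp.single_eq_of_ne (Ne.symm hmm)]; exact zero_mem _

theorem indPi_eq_xiCoord (t : Ind φ N) :
    indPi φ N t = xiCoord N hpoly.homog hpoly.basis t (monZero degX) := by
  have : indPi φ N = Finsupp.lapply (monZero degX) ∘ₗ
      (xiCoord N hpoly.homog hpoly.basis).toLinearMap := by
    refine LinearMap.ext_on (span_xim_tone hpoly) ?_
    rintro _ ⟨m, i, x, -, rfl⟩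
    simp only [LinearMap.comp_apply, LinearEquiv.coe_coe, xiCoord_xim, Finsupp.lapply_apply]
    by_cases hm : m = monZero degX
    · subst hm
      simp [xim, tone_apply, N.smul_one]
    · rw [Finsupp.single_eq_of_ne (Ne.symm hm), xim, mon]
      cases hword : word m.1 with
      | nil =>
        refine absurd (Subtype.ext (Finsupp.ext fun i => ?_)) hm
        rw [← count_word, hword]; rfl
      | cons i l => rw [List.map_cons, List.prod_cons, Module.End.mul_apply, indPi_xi]
  exact LinearMap.congr_fun this t

include hpoly in
theorem indPi_eq_zero_iff (hw : ∀ i, 1 ≤ w i) {t : Ind φ N} :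
    indPi φ N t = 0 ↔ t ∈ filt φ N X degX w 1 := by
  rw [indPi_eq_xiCoord hpoly, mem_filt_iff hpoly]
  refine ⟨fun h m hm => ?_, fun h => h _ (by simp)⟩
  suffices hm0 : m = monZero degX by rw [hm0, h]
  cases hword : word m.1 with
  | nil =>
    refine Subtype.ext (Finsupp.ext fun i => ?_)
    rw [← count_word, hword]; rfl
  | cons i l =>
    rw [wsum, hword, List.map_cons, List.sum_cons] at hm
    have := hw i
    omega

end Coord

end Filtration

section

theorem ksign_one : ksign 1 = -1 := by simp [ksign_eq_ite]

section Semifree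

variable {R : Type} [CommRing R] {B : DGAlgebra R} {N W : DGModule R B}

/-- The zero graded homomorphism. -/
instance (k : ℤ) : Inhabited (GradedHom N W k) where
  default :=
    { toFun := fun _ => 0
      map_add := fun _ _ => (add_zero 0).symm
      map_rsmul := fun _ _ => (smul_zero _).symm
      map_smul := fun _ b => (LinearMap.map_zero₂ (act W) b).symm
      map_mem := fun _ => zero_mem _ }

/-- The difference of two graded homomorphisms. -/
instance (k : ℤ) : Sub (GradedHom N W k) where
  sub f g :=
    { toFun := fun x => f.toFun x - g.toFun x
      map_add := fun x y => by rw [f.map_add, g.map_add, add_sub_add_comm]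
      map_rsmul := fun r x => by rw [f.map_rsmul, g.map_rsmul, smul_sub]
      map_smul := fun x b => by
        rw [f.map_smul, g.map_smul, ← act_apply, ← act_apply, ← act_apply, map_sub,
          LinearMap.sub_apply]
      map_mem := fun hx => sub_mem (f.map_mem hx) (g.map_mem hx) }

@[simp] theorem GradedHom.sub_toFun {k : ℤ} (f g : GradedHom N W k) (x : N.carrier) :
    (f - g).toFun x = f.toFun x - g.toFun x := rfl

/-- The boundary `d f - f d` of a degree `0` element `f` of the Hom complex. -/
def defect (f : GradedHom N W 0) : GradedHom N W (-1) where
  toFun x := W.d (f.toFun x) - f.toFun (N.d x)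
  map_add x y := by rw [f.map_add, N.d_add, W.d_add, f.map_add, add_sub_add_comm]
  map_rsmul r x := by rw [f.map_rsmul, N.d_rsmul, W.d_rsmul, f.map_rsmul, smul_sub]
  map_smul x b := by
    have : modD W ∘ₗ gradedLin f ∘ₗ (act N).flip b - gradedLin f ∘ₗ modD N ∘ₗ (act N).flip b =
        (act W).flip b ∘ₗ (modD W ∘ₗ gradedLin f - gradedLin f ∘ₗ modD N) :=
      hom_ext_graded N.grading fun i x hx => by
        have hfx := f.map_mem hx
        rw [add_zero] at hfx
        simp only [LinearMap.sub_apply, LinearMap.comp_apply, LinearMap.flip_apply, act_apply,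
          modD_apply, gradedLin_apply, f.map_smul, N.leibniz x b hx, W.leibniz _ b hfx, map_sub,
          f.map_add]
        rw [← gradedLin_apply f (ksign i • _), map_zsmul, gradedLin_apply, f.map_smul,
          ← act_apply, ← act_apply, ← act_apply]
        abel
    exact LinearMap.congr_fun this x
  map_mem {i x} hx := by
    have h1 := W.d_mem (f.map_mem hx)
    have h2 := f.map_mem (N.d_mem hx)
    rw [add_zero] at h1 h2
    exact sub_mem h1 h2

theorem defect_apply (f : GradedHom N W 0) (x : N.carrier) :
    (defect f).toFun x = W.d (f.toFun x) - f.toFun (N.d x) := rfl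

theorem defect_sub (f g : GradedHom N W 0) (x : N.carrier) :
    (defect (f - g)).toFun x = (defect f).toFun x - (defect g).toFun x := by
  simp only [defect_apply, GradedHom.sub_toFun]
  rw [← modD_apply, map_sub, modD_apply, modD_apply, sub_sub_sub_comm]

theorem d_defect (f : GradedHom N W 0) (x : N.carrier) :
    W.d ((defect f).toFun x) = -(defect f).toFun (N.d x) := by
  rw [defect_apply, defect_apply, ← modD_apply, map_sub, modD_apply, modD_apply, W.d_sq, N.d_sq,
    ← gradedLin_apply f 0, map_zero, zero_sub, sub_zero]

variable {κ : Type} {e : κ → N.carrier} (S : SemifreeBasisOn N e)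

/-- The coordinates of a semifree DG module. -/
def semifreeEquiv : (κ →₀ B.carrier) ≃ₗ[R] N.carrier :=
  LinearEquiv.ofBijective (Finsupp.lsum R fun k => act N (e k)) S.basis

theorem semifreeEquiv_single (k : κ) (b : B.carrier) :
    semifreeEquiv S (Finsupp.single k b) = N.smul (e k) b :=
  (Finsupp.lsum_single R (fun k => act N (e k)) k b :)

include S in
theorem semifree_induction {P : Submodule R N.carrier} (h : ∀ k b, N.smul (e k) b ∈ P)
    (x : N.carrier) : x ∈ P := by
  obtain ⟨c, rfl⟩ := (semifreeEquiv S).surjective x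
  induction c using Finsupp.induction_linear with
  | zero => rw [map_zero]; exact zero_mem _
  | add c c' hc hc' => rw [map_add]; exact add_mem hc hc'
  | single k b => rw [semifreeEquiv_single]; exact h k b

theorem exists_extension {l : ℤ} (y : κ → W.carrier)
    (hy : ∀ k, y k ∈ W.grading (S.deg k + l)) :
    ∃ f : GradedHom N W l, ∀ k, f.toFun (e k) = y k := by
  let f : N.carrier →ₗ[R] W.carrier :=
    (Finsupp.lsum R fun k => act W (y k)) ∘ₗ (semifreeEquiv S).symm.toLinearMap
  have hf (k : κ) (b : B.carrier) : f (N.smul (e k) b) = W.smul (y k) b := by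
    rw [← semifreeEquiv_single S]
    simp only [f, LinearMap.comp_apply, LinearEquiv.coe_coe, LinearEquiv.symm_apply_apply]
    rw [Finsupp.lsum_single, act_apply]
  refine ⟨⟨f, map_add f, map_smul f, fun x b => ?_, fun {i x} hx => ?_⟩, fun k => ?_⟩
  · refine semifree_induction S (P := LinearMap.eqLocus (f ∘ₗ (act N).flip b)
      ((act W).flip b ∘ₗ f)) (fun k c => ?_) x
    simp [hf, N.smul_mul, W.smul_mul]
  · refine map_mem_of_span N.grading W.grading f l ?_ hx
    rw [eq_top_iff]
    intro x _
    refine semifree_induction S (fun k b => ?_) x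
    induction b using DirectSum.Decomposition.inductionOn B.grading with
    | zero => rw [← act_apply, map_zero]; exact zero_mem _
    | add b c hb hc => rw [N.smul_add]; exact add_mem hb hc
    | @homogeneous j b =>
      refine Submodule.subset_span ⟨_, N.smul_mem (S.homog k) b.2, ?_⟩
      rw [hf, add_right_comm]
      exact W.smul_mem (hy k) b.2
  · change f (e k) = y k
    rw [← N.smul_one (e k), hf, W.smul_one]

end Semifree

section Lift

variable {R : Type} [CommRing R] {A B : DGAlgebra R} {φ : DGAlgHom A B} {N : DGModule R B}

theorem indPi_indAct (b : B.carrier) (t : Ind φ N) :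
    indPi φ N (indAct φ N b t) = N.smul (indPi φ N t) b := by
  have : indPi φ N ∘ₗ indAct φ N b = (act N).flip b ∘ₗ indPi φ N :=
    ind_hom_ext fun i j x c hx hc => by simp [indAct_tmk, N.smul_mul]
  exact LinearMap.congr_fun this t

theorem indPi_indD (t : Ind φ N) : indPi φ N (indD φ N t) = N.d (indPi φ N t) := by
  have : indPi φ N ∘ₗ indD φ N = modD N ∘ₗ indPi φ N :=
    ind_hom_ext fun i j x c hx hc => by simp [indD_tmk φ N hx, N.leibniz x c hx]
  exact LinearMap.congr_fun this t

variable (φ N) in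
/-- The canonical epimorphism `N|_A ⊗_A B → N`. -/
def indPiHom : DGHom (indModule φ N) N where
  toFun := indPi φ N
  map_add := map_add _
  map_rsmul := map_smul _
  map_smul t b := indPi_indAct b t
  map_mem {i} t ht := by
    have := map_mem_of_tmk (φ := φ) (N := N) N.grading (indPi φ N) 0 (fun i j x b hx hb => by
      simpa using N.smul_mem hx hb) ht
    rwa [add_zero] at this
  comm_d := indPi_indD

variable {ι : Type} [LinearOrder ι] {X : ι → B.carrier} {degX : ι → ℤ}
  (hpoly : PolyExt φ ι X degX) {w : ι → ℕ}

theorem wsum_le {C : ℕ} (hC : ∀ i, (w i : ℤ) ≤ C * degX i) (m : MonIdx ι degX) :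
    ((wsum w m : ℕ) : ℤ) ≤ C * wsum degX m := by
  rw [wsum, wsum]
  induction word m.1 with
  | nil => simp
  | cons i l ih =>
    simp only [List.map_cons, List.sum_cons, Nat.cast_add, mul_add]
    exact add_le_add (hC i) ih

include hpoly in
theorem wsum_degX_nonneg (m : MonIdx ι degX) : 0 ≤ wsum degX m :=
  List.sum_nonneg fun _ h => by
    obtain ⟨i, -, rfl⟩ := List.mem_map.1 h
    exact (hpoly.pos_deg i).le

include hpoly in
theorem indAct_filt (b : B.carrier) {k : ℕ} {t : Ind φ N} (ht : t ∈ filt φ N X degX w k) :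
    indAct φ N b t ∈ filt φ N X degX w k := by
  refine filt_le (S := (filt φ N X degX w k).comap (indAct φ N b)) (fun m x hm => ?_) ht
  rw [Submodule.mem_comap, ← xim_indAct]
  refine filt_anti ?_ (xim_filt hpoly.homog m (k := 0) (t := indAct φ N b (tone φ N x))
    (by rw [filt_zero hpoly]; trivial))
  omega

include hpoly in
theorem indD_filt (hw : ∀ i j, i < j → w j + 1 ≤ w i) {k : ℕ} {t : Ind φ N}
    (ht : t ∈ filt φ N X degX w k) : indD φ N t ∈ filt φ N X degX w k := by
  refine filt_le (S := (filt φ N X degX w k).comap (indD φ N)) (fun m x hm => ?_) ht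
  have h := indD_xim hpoly hw m (tone φ N x)
  rw [indD_tone] at h
  have h' := add_mem (filt_anti (hm.trans (Nat.le_succ _)) h)
    (zsmul_mem (xim_tone_mem_filt hm (N.d x)) (ksign (wsum degX m)))
  rwa [sub_add_cancel] at h'

include hpoly in
theorem exists_filt_vanish (hbb : BoundedBelow N) {C : ℕ} (hC : ∀ i, (w i : ℤ) ≤ C * degX i)
    (i : ℤ) : ∃ K : ℕ, ∀ k, K ≤ k → ∀ t ∈ indGrading φ N i, t ∈ filt φ N X degX w k → t = 0 := by
  obtain ⟨n₀, hn₀⟩ := hbb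
  refine ⟨(C * (i - n₀)).toNat + 1, fun k hk t hti htk => ?_⟩
  refine (xiCoord N hpoly.homog hpoly.basis).map_eq_zero_iff.1 (Finsupp.ext fun m => ?_)
  rcases lt_or_ge (wsum w m) k with h | h
  · exact xiCoord_of_mem_filt hpoly htk h
  · have hm := xiCoord_mem hpoly m hti
    have h1 := wsum_le hC m
    have h2 : (C * (i - n₀) : ℤ) < C * wsum degX m := by omega
    have h3 := lt_of_mul_lt_mul_left h2 (Nat.cast_nonneg C)
    rw [hn₀ _ (by omega)] at hm
    exact (Submodule.mem_bot R).1 hm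

/-- The `m`-th coordinate of a graded homomorphism into `N|_A ⊗_A B` of filtration at least
the weight of `m`. -/
def coordHom (hw : ∀ i, 1 ≤ w i) {l l' : ℤ} (m : MonIdx ι degX)
    (f : GradedHom N (indModule φ N) l)
    (hf : ∀ x, f.toFun x ∈ filt φ N X degX w (wsum w m)) (hl : l' = l + -wsum degX m) :
    GradedHom N N l' where
  toFun x := xiCoord N hpoly.homog hpoly.basis (f.toFun x) m
  map_add x y := by rw [f.map_add]; exact DFunLike.congr_fun (map_add _ _ _) m
  map_rsmul r x := by rw [f.map_rsmul]; exact DFunLike.congr_fun (map_smul _ _ _) m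
  map_smul x b := by rw [f.map_smul]; exact xiCoord_indAct hpoly hw b (hf x)
  map_mem {i x} hx := by rw [hl, ← add_assoc]; exact xiCoord_mem hpoly m (f.map_mem hx)

include hpoly in
theorem exists_filt_step [Finite ι] (hw : ∀ i, 1 ≤ w i) (hw' : ∀ i j, i < j → w j + 1 ≤ w i)
    (hsf : IsSemifree N) (hext : ∀ i : ℤ, 0 < i → ExtVanish i N N) (k : ℕ)
    (ρ : GradedHom N (indModule φ N) 0)
    (hρ : ∀ x, (defect ρ).toFun x ∈ filt φ N X degX w k) :
    ∃ ρ' : GradedHom N (indModule φ N) 0,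
      (∀ x, (defect ρ').toFun x ∈ filt φ N X degX w (k + 1)) ∧
      ∀ x, ρ'.toFun x - ρ.toFun x ∈ filt φ N X degX w k := by
  classical
  set q := xiCoord N hpoly.homog hpoly.basis with hq
  have hh : ∀ m : MonIdx ι degX, ∃ h : GradedHom N N (-(1 + wsum degX m) + 1), wsum w m = k →
      ∀ x, q ((defect ρ).toFun x) m =
        N.d (h.toFun x) + ksign (1 + wsum degX m) • h.toFun (N.d x) := fun m => by
    by_cases hm : wsum w m = k
    · subst hm
      obtain ⟨h, hh⟩ := hext (1 + wsum degX m)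
        (by have := wsum_degX_nonneg hpoly m; omega)
        (coordHom hpoly hw m (defect ρ) hρ (by ring)) fun x => by
          change N.d (q _ m) = _ • q _ m
          have h1 := xiCoord_indD hpoly hw' (hρ x)
          have h2 : indD φ N ((defect ρ).toFun x) = -(defect ρ).toFun (N.d x) := d_defect ρ x
          rw [h2] at h1
          have h3 := congrArg (ksign (wsum degX m) • ·)
            ((DFunLike.congr_fun (map_neg q ((defect ρ).toFun (N.d x))) m).symm.trans h1)
          simp only [ksign_smul_smul, ← hq, Finsupp.neg_apply] at h3
          rw [← h3, ksign_add, ksign_one, neg_one_mul, smul_neg, neg_smul]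
      exact ⟨h, fun _ => hh⟩
    · exact ⟨default, fun h => absurd h hm⟩
  choose h hh using hh
  obtain ⟨κ, e, ⟨S⟩⟩ := hsf
  have hfin := finite_wsum_eq (deg := degX) w hw k
  obtain ⟨H, hH⟩ := exists_extension (W := indModule φ N) (l := 0) S
    (fun j => ∑ m ∈ hfin.toFinset,
      ksign (wsum degX m) • xim φ N X degX m (tone φ N ((h m).toFun (e j)))) fun j => by
    refine Submodule.sum_mem _ fun m _ => zsmul_mem ?_ _
    have := xim_mem (φ := φ) (N := N) hpoly.homog m (tone_mem ((h m).map_mem (S.homog j)))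
    rwa [add_assoc, show -(1 + wsum degX m) + 1 + wsum degX m = 0 by ring] at this
  have hHk (x : N.carrier) : H.toFun x ∈ filt φ N X degX w k := by
    refine semifree_induction S (P := (filt φ N X degX w k).comap (gradedLin H))
      (fun j b => ?_) x
    rw [Submodule.mem_comap, gradedLin_apply, H.map_smul, hH]
    exact indAct_filt hpoly b (Submodule.sum_mem _ fun m hm => zsmul_mem
      (xim_tone_mem_filt (hfin.mem_toFinset.1 hm).ge _) _)
  have hqH (m : MonIdx ι degX) (hm : wsum w m = k) (x : N.carrier) :
      q (H.toFun x) m = ksign (wsum degX m) • (h m).toFun x := by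
    refine semifree_induction S (P := LinearMap.eqLocus
      (Finsupp.lapply m ∘ₗ q.toLinearMap ∘ₗ gradedLin H)
      (ksign (wsum degX m) • gradedLin (h m))) (fun j b => ?_) x
    change q (H.toFun _) m = ksign (wsum degX m) • (h m).toFun _
    rw [H.map_smul, (h m).map_smul, ← smul_zsmul_left]
    refine (xiCoord_indAct hpoly hw b (hm ▸ hHk (e j))).trans (congrArg (N.smul · b) ?_)
    have h1 : ∀ m', q (ksign (wsum degX m') • xim φ N X degX m' (tone φ N ((h m').toFun (e j)))) m
        = if m' = m then ksign (wsum degX m) • (h m).toFun (e j) else 0 := fun m' => by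
      rw [map_zsmul, xiCoord_xim, Finsupp.smul_apply]
      split_ifs with hmm
      · subst hmm; rw [Finsupp.single_eq_same]
      · rw [Finsupp.single_eq_of_ne (Ne.symm hmm), smul_zero]
    rw [hH, map_sum, Finsupp.finsetSum_apply, Finset.sum_congr rfl fun m' _ => h1 m',
      Finset.sum_ite_eq', if_pos (hfin.mem_toFinset.2 hm)]
  refine ⟨ρ - H, fun x => ?_, fun x => ?_⟩
  · rw [defect_sub]
    refine (mem_filt_iff hpoly).2 fun m hm => ?_
    refine (DFunLike.congr_fun (map_sub _ _ _) m).trans ?_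
    rw [Finsupp.sub_apply, sub_eq_zero]
    rcases (Nat.lt_succ_iff.1 hm).lt_or_eq with hlt | heq
    · rw [xiCoord_of_mem_filt hpoly (hρ x) hlt, defect_apply]
      refine (xiCoord_of_mem_filt hpoly (sub_mem (indD_filt hpoly hw' (hHk x)) (hHk _)) hlt).symm
    · rw [defect_apply]
      refine (hh m heq x).trans (Eq.trans ?_ (DFunLike.congr_fun (map_sub q _ _) m).symm)
      rw [Finsupp.sub_apply, hqH m heq]
      refine Eq.trans ?_ (congrArg (· - _) (xiCoord_indD hpoly hw' (heq ▸ hHk x)).symm)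
      rw [← hq, hqH m heq, modD_zsmul, ksign_smul_smul, ksign_add]
      rw [ksign_one, neg_one_mul, neg_smul, sub_eq_add_neg]
  · simpa using hHk x

end Lift

end

section Limit

variable {R : Type} [CommRing R] {A B : DGAlgebra R}

theorem eventually_of_homogeneous {N W : DGModule R B} (f : ℕ → N.carrier →ₗ[R] W.carrier)
    (h : ∀ i, ∀ x ∈ N.grading i, ∃ K, ∀ k, K ≤ k → f k x = 0) (x : N.carrier) :
    ∃ K, ∀ k, K ≤ k → f k x = 0 := by
  induction x using DirectSum.Decomposition.inductionOn N.grading with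
  | zero => exact ⟨0, fun k _ => map_zero _⟩
  | homogeneous x => exact h _ x x.2
  | add x y hx hy =>
    obtain ⟨K, hK⟩ := hx
    obtain ⟨L, hL⟩ := hy
    refine ⟨max K L, fun k hk => ?_⟩
    rw [map_add, hK k (le_of_max_le_left hk), hL k (le_of_max_le_right hk), add_zero]

/-- A sequence of graded homomorphisms which is eventually constant on every element, with
defects eventually vanishing on every element, converges to a DG homomorphism. -/
theorem exists_limit {N W : DGModule R B} (ρ : ℕ → GradedHom N W 0)
    (hρ : ∀ x, ∃ K, ∀ k, K ≤ k → (ρ (k + 1)).toFun x = (ρ k).toFun x)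
    (hd : ∀ x, ∃ K, ∀ k, K ≤ k → (defect (ρ k)).toFun x = 0) :
    ∃ f : DGHom N W, ∀ x, ∃ k, f.toFun x = (ρ k).toFun x := by
  have hρ' : ∀ x, ∃ y, ∀ᶠ k in Filter.atTop, (ρ k).toFun x = y := fun x => by
    obtain ⟨K, hK⟩ := hρ x
    refine ⟨(ρ K).toFun x, Filter.eventually_atTop.2 ⟨K, fun k hk => ?_⟩⟩
    induction k, hk using Nat.le_induction with
    | base => rfl
    | succ k hk ih => rw [hK k hk, ih]
  choose f hf using hρ'
  refine ⟨⟨f, fun x y => ?_, fun r x => ?_, fun x b => ?_, fun {i x} hx => ?_, fun x => ?_⟩,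
    fun x => (hf x).exists.imp fun k hk => hk.symm⟩
  · obtain ⟨k, h1, h2, h3⟩ := ((hf (x + y)).and ((hf x).and (hf y))).exists
    rw [← h1, ← h2, ← h3, (ρ k).map_add]
  · obtain ⟨k, h1, h2⟩ := ((hf (r • x)).and (hf x)).exists
    rw [← h1, ← h2, (ρ k).map_rsmul]
  · obtain ⟨k, h1, h2⟩ := ((hf (N.smul x b)).and (hf x)).exists
    rw [← h1, ← h2, (ρ k).map_smul]
  · obtain ⟨k, h1⟩ := (hf x).exists
    rw [← h1]
    simpa using (ρ k).map_mem hx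
  · obtain ⟨k, h1, h2, h3⟩ :=
      ((hf (N.d x)).and ((hf x).and (Filter.eventually_atTop.2 (hd x)))).exists
    rw [← h1, ← h2]
    exact (sub_eq_zero.1 h3).symm

variable {φ : DGAlgHom A B} {N : DGModule R B} {ι : Type} [LinearOrder ι] {X : ι → B.carrier}
  {degX : ι → ℤ} (hpoly : PolyExt φ ι X degX) {w : ι → ℕ}

include hpoly in
theorem exists_section [Finite ι] (hw : ∀ i, 1 ≤ w i) (hw' : ∀ i j, i < j → w j + 1 ≤ w i)
    {C : ℕ} (hC : ∀ i, (w i : ℤ) ≤ C * degX i) (hsf : IsSemifree N) (hbb : BoundedBelow N)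
    (hext : ∀ i : ℤ, 0 < i → ExtVanish i N N) :
    ∃ f : DGHom N (indModule φ N), ∀ x, indPi φ N (f.toFun x) = x := by
  obtain ⟨ρ₀, hρ₀⟩ : ∃ ρ : GradedHom N (indModule φ N) 0, ∀ x, indPi φ N (ρ.toFun x) = x := by
    obtain ⟨κ, e, ⟨S⟩⟩ := hsf
    obtain ⟨ρ, hρ⟩ := exists_extension (W := indModule φ N) (l := 0) S
      (fun j => tone φ N (e j)) fun j => by rw [add_zero]; exact tone_mem (S.homog j)
    refine ⟨ρ, fun x => semifree_induction S
      (P := LinearMap.eqLocus (indPi φ N ∘ₗ gradedLin ρ) LinearMap.id) (fun j b => ?_) x⟩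
    change indPi φ N (ρ.toFun _) = N.smul (e j) b
    rw [ρ.map_smul, hρ]
    exact (indPi_indAct b _).trans (by rw [tone_apply, indPi_tmk, N.smul_one])
  let P (k : ℕ) (ρ : GradedHom N (indModule φ N) 0) : Prop :=
    (∀ x, indPi φ N (ρ.toFun x) = x) ∧ ∀ x, (defect ρ).toFun x ∈ filt φ N X degX w (k + 1)
  have hstep : ∀ k (ρ : {ρ // P k ρ}), ∃ ρ' : {ρ // P (k + 1) ρ},
      ∀ x, ρ'.1.toFun x - ρ.1.toFun x ∈ filt φ N X degX w (k + 1) := fun k ρ => by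
    obtain ⟨ρ', h1, h2⟩ := exists_filt_step hpoly hw hw' hsf hext (k + 1) ρ.1 ρ.2.2
    refine ⟨⟨ρ', fun x => ?_, h1⟩, h2⟩
    have h3 := (indPi_eq_zero_iff hpoly hw).2 (filt_anti (Nat.le_add_left 1 k) (h2 x))
    rw [map_sub, ρ.2.1, sub_eq_zero] at h3
    exact h3
  have hP₀ : P 0 ρ₀ := ⟨hρ₀, fun x => (indPi_eq_zero_iff hpoly hw).1 <| by
    rw [defect_apply, map_sub, hρ₀]
    exact sub_eq_zero.2 ((indPi_indD _).trans (by rw [hρ₀]))⟩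
  choose step hstep using hstep
  let ρ (k : ℕ) : {ρ // P k ρ} := Nat.rec ⟨ρ₀, hP₀⟩ step k
  have hsub (i : ℤ) : ∀ x ∈ N.grading i, ∃ K, ∀ k, K ≤ k →
      (gradedLin (ρ (k + 1)).1 - gradedLin (ρ k).1) x = 0 := fun x hx => by
    obtain ⟨K, hK⟩ := exists_filt_vanish hpoly hbb hC i
    refine ⟨K, fun k hk => hK (k + 1) (by omega) _ ?_ (hstep k (ρ k) x)⟩
    have := sub_mem ((ρ (k + 1)).1.map_mem hx) ((ρ k).1.map_mem hx)
    rwa [add_zero] at this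
  have hdef (i : ℤ) : ∀ x ∈ N.grading i, ∃ K, ∀ k, K ≤ k →
      gradedLin (defect (ρ k).1) x = 0 := fun x hx => by
    obtain ⟨K, hK⟩ := exists_filt_vanish hpoly hbb hC (i + -1)
    exact ⟨K, fun k hk => hK (k + 1) (by omega) _ ((defect (ρ k).1).map_mem hx)
      ((ρ k).2.2 x)⟩
  obtain ⟨f, hf⟩ := exists_limit (fun k => (ρ k).1)
    (fun x => (eventually_of_homogeneous _ hsub x).imp fun K hK k hk => sub_eq_zero.1 (hK k hk))
    (eventually_of_homogeneous _ hdef)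
  refine ⟨f, fun x => ?_⟩
  obtain ⟨k, hk⟩ := hf x
  rw [hk]
  exact (ρ k).2.1 x

end Limit

section Universal

variable {R : Type} [CommRing R] {A B : DGAlgebra R} (φ : DGAlgHom A B) (N : DGModule R B)

/-- Restriction of scalars of a DG module. -/
abbrev restrict : DGModule R A where
  carrier := N.carrier
  grading := N.grading
  indep := N.indep
  spanning := N.spanning
  smul x a := N.smul x (φ.toFun a)
  smul_add x a b := by rw [φ.map_add, N.smul_add]
  add_smul x y a := N.add_smul _ _ _
  smul_rsmul r x a := by rw [φ.map_rsmul, N.smul_rsmul]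
  rsmul_smul r x a := N.rsmul_smul _ _ _
  smul_one x := by rw [φ.map_one, N.smul_one]
  smul_mul x a b := by rw [φ.map_mul, N.smul_mul]
  smul_mem hx ha := N.smul_mem hx (φ.map_mem ha)
  d := N.d
  d_add := N.d_add
  d_rsmul := N.d_rsmul
  d_mem := N.d_mem
  d_sq := N.d_sq
  leibniz x a hx := by rw [φ.comm_d, N.leibniz _ _ hx]

/-- The unit `x ↦ x ⊗ 1` of the induced module. -/
def indUnit : ResHomB φ N (indModule φ N) where
  toFun := tone φ N
  map_add := map_add _
  map_rsmul := map_smul _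
  map_mem := tone_mem
  map_smul x a := by
    change _ = indAct φ N _ _
    rw [tone_apply, tone_apply, tmk_balanced, indAct_tmk, mul_one, one_mul]
  comm_d x := (indD_tone x).symm

variable {φ N}

theorem ind_univ {W : DGModule R B} (f : ResHomB φ N W) :
    ∃ g : DGHom (indModule φ N) W, (∀ x, g.toFun (tone φ N x) = f.toFun x) ∧
      ∀ g' : DGHom (indModule φ N) W, (∀ x, g'.toFun (tone φ N x) = f.toFun x) →
        ∀ t, g'.toFun t = g.toFun t := by
  let fl : N.carrier →ₗ[R] W.carrier := ⟨⟨f.toFun, f.map_add⟩, f.map_rsmul⟩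
  have hfl (x) : fl x = f.toFun x := rfl
  let g : Ind φ N →ₗ[R] W.carrier := tlift (act W ∘ₗ fl) fun i j k x a b _ _ _ => by
    simp [hfl, f.map_smul, W.smul_mul]
  have hg (x b) : g (tmk φ N x b) = W.smul (f.toFun x) b := rfl
  refine ⟨⟨g, map_add g, map_smul g, fun t b => ?_, fun {i t} ht => ?_, fun t => ?_⟩,
    fun x => ?_, fun g' hg' t => ?_⟩
  · have : g ∘ₗ indAct φ N b = (act W).flip b ∘ₗ g :=
      ind_hom_ext fun i j x c hx hc => by simp [indAct_tmk, hg, W.smul_mul]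
    exact LinearMap.congr_fun this t
  · have := map_mem_of_tmk W.grading g 0 (fun i j x b hx hb => by
      rw [hg, add_zero]; exact W.smul_mem (f.map_mem hx) hb) ht
    rwa [add_zero] at this
  · have : g ∘ₗ indD φ N = modD W ∘ₗ g :=
      ind_hom_ext fun i j x c hx hc => by
        simp [indD_tmk φ N hx, hg, f.comm_d, W.leibniz _ c (f.map_mem hx)]
    exact LinearMap.congr_fun this t
  · change g (tone φ N x) = _
    rw [tone_apply, hg, W.smul_one]
  · have : homLin g' = g := ind_hom_ext fun i j x c hx hc => by
      have h := g'.map_smul (tone φ N x) c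
      rw [hg', ← hg] at h
      rw [homLin_apply, ← h]
      change _ = g'.toFun (indAct φ N c _)
      rw [tone_apply, indAct_tmk, one_mul]
    exact LinearMap.congr_fun this t

theorem liftableTo_indModule : LiftableTo φ (indModule φ N) :=
  ⟨restrict φ N, ⟨{
    unit := ⟨tone φ N, (indUnit φ N).map_add, (indUnit φ N).map_rsmul, (indUnit φ N).map_mem,
      (indUnit φ N).map_smul, (indUnit φ N).comm_d⟩
    univ := fun W f => ind_univ (φ := φ) (N := N) (W := W)
      ⟨f.toFun, f.map_add, f.map_rsmul, f.map_mem, f.map_smul, f.comm_d⟩ }⟩⟩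

/-- A section of the canonical epimorphism from the explicit model of the induced module yields
one for every model. -/
theorem naivelyLiftable_of_section (ρ : DGHom N (indModule φ N))
    (hρ : ∀ x, indPi φ N (ρ.toFun x) = x) : NaivelyLiftable φ N := by
  intro T h πN hπN
  obtain ⟨g, hg, -⟩ := ind_univ h.unit
  obtain ⟨p, -, hp⟩ := ind_univ (φ := φ) (N := N) (W := N)
    ⟨id, fun _ _ => rfl, fun _ _ => rfl, id, fun _ _ => rfl, fun _ => rfl⟩
  have h1 := hp ⟨fun t => πN.toFun (g.toFun t), fun _ _ => by rw [g.map_add, πN.map_add],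
    fun _ _ => by rw [g.map_rsmul, πN.map_rsmul], fun _ _ => by rw [g.map_smul, πN.map_smul],
    fun ht => πN.map_mem (g.map_mem ht), fun _ => by rw [g.comm_d, πN.comm_d]⟩
    fun x => (congrArg πN.toFun (hg x)).trans (hπN x)
  have h2 := hp (indPiHom φ N) fun x => by
    change indPi φ N (tone φ N x) = x
    rw [tone_apply, indPi_tmk, N.smul_one]
  refine ⟨⟨fun x => g.toFun (ρ.toFun x), fun _ _ => by rw [ρ.map_add, g.map_add],
    fun _ _ => by rw [ρ.map_rsmul, g.map_rsmul], fun _ _ => by rw [ρ.map_smul, g.map_smul],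
    fun hx => g.map_mem (ρ.map_mem hx), fun _ => by rw [ρ.comm_d, g.comm_d]⟩, fun y => ?_⟩
  exact ((h1 _).trans (h2 _).symm).trans (hρ y)

end Universal

end NaiveLift

end

/-- Let `B = A[X_1, …, X_n]` be a polynomial extension of a strongly
commutative DG `R`-algebra `A` by variables of positive degrees (`n ≥ 1`). If `N` is
a bounded below semifree DG `B`-module with `Ext^i_B(N, N) = 0` for all `i > 0`,
then `N` is naively liftable to `A`, and `N` is a direct summand of a DG `B`-module
that is liftable to `A`. -/
theorem naive_lifting_of_polynomial_extension
    {R : Type} [CommRing R] {A B : DGAlgebra R} (φ : DGAlgHom A B)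
    (n : ℕ) (hn : 0 < n) (X : Fin n → B.carrier) (degX : Fin n → ℤ)
    (hpoly : PolyExt φ (Fin n) X degX)
    (N : DGModule R B) (hsf : IsSemifree N) (hbb : BoundedBelow N)
    (hext : ∀ i : ℤ, 0 < i → ExtVanish i N N) :
    NaivelyLiftable φ N ∧ DirectSummandOfLiftable φ N := by
  obtain ⟨ρ, hρ⟩ := NaiveLift.exists_section hpoly (w := fun i => n - i) (C := n)
    (fun i => by have := i.2; omega) (fun i j hij => by have := j.2; omega)
    (fun i => by
      have h1 : ((n - i : ℕ) : ℤ) ≤ n := by omega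
      exact h1.trans (le_mul_of_one_le_right (Nat.cast_nonneg n) (hpoly.pos_deg i)))
    hsf hbb hext
  exact ⟨NaiveLift.naivelyLiftable_of_section ρ hρ, NaiveLift.indModule φ N,
    NaiveLift.liftableTo_indModule, ρ, NaiveLift.indPiHom φ N, hρ⟩
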